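/- (E2TC with T₂ = 0, data-rich regime.) Run E2TC with only the first exploration stage and regularization λ = 7B_φ² (log T₁)/T₁, committing greedily to w₀ and θ₀ afterwards. For every a > 0 there exist N₀(a) ∈ ℕ and a constant C > 0 depending only on B_w, B_φ, B_η such that whenever T₁ > max{N₀(a), d^{1/a}}, simultaneously: (1) with probability greater than 1 − 4/√T₁, ‖w₀ − w*‖²_{Σ₀} ≤ C( ε₀²d + d/T₁ + √(d log T₁)/T₁ + (log T₁)/T₁ ); and (2) the expected pseudo-regret satisfies E[R_{1:T}] ≤ C( ε₀√d·KT + T/√T₁ + T₁ + KT(√(d/T₁) + d^{1/4}(log T₁)^{1/4}/√T₁ + √((log T₁)/T₁)) ). -/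

import Mathlib

open MeasureTheory Matrix Real
open scoped ENNReal

/-- Euclidean norm of a vector in `Fin n → ℝ`. -/
noncomputable def vnorm {n : ℕ} (v : Fin n → ℝ) : ℝ := Real.sqrt (v ⬝ᵥ v)

/-- Matrix-weighted (semi-)norm `‖v‖_M = √(vᵀ M v)`. -/
noncomputable def mnorm {n : ℕ} (M : Matrix (Fin n) (Fin n) ℝ) (v : Fin n → ℝ) : ℝ :=
  Real.sqrt (v ⬝ᵥ (M *ᵥ v))

open MeasureTheory Matrix Real
open scoped ENNReal

namespace E2TC

lemma trace_pow_comm {n m : ℕ} (A : Matrix (Fin n) (Fin m) ℝ) (B : Matrix (Fin m) (Fin n) ℝ) (k : ℕ)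
    (hk : 0 < k) : ((A * B) ^ k).trace = ((B * A) ^ k).trace := by
  obtain ⟨k, rfl⟩ : ∃ j, k = j + 1 := ⟨k - 1, by omega⟩
  have h : ∀ j : ℕ, (A * B) ^ (j + 1) = A * (B * A) ^ j * B := by
    intro j
    induction j with
    | zero => simp
    | succ j ih => rw [pow_succ, ih, pow_succ]; simp only [Matrix.mul_assoc]
  rw [h, Matrix.trace_mul_comm, ← Matrix.mul_assoc, ← pow_succ']

lemma trace_mul_le {n : ℕ} (X Y : Matrix (Fin n) (Fin n) ℝ) :
    (X * Y).trace ≤ ((X * Xᵀ).trace + (Yᵀ * Y).trace) / 2 := by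
  have : (0:ℝ) ≤ ((X - Yᵀ) * (X - Yᵀ)ᵀ).trace := by
    have := (Matrix.posSemidef_self_mul_conjTranspose (X - Yᵀ)).trace_nonneg
    simpa [Matrix.conjTranspose_eq_transpose_of_trivial] using this
  have e : ((X - Yᵀ) * (X - Yᵀ)ᵀ).trace
      = (X * Xᵀ).trace + (Yᵀ * Y).trace - 2 * (X * Y).trace := by
    rw [Matrix.transpose_sub, Matrix.transpose_transpose, Matrix.sub_mul, Matrix.mul_sub,
      Matrix.mul_sub, Matrix.trace_sub, Matrix.trace_sub, Matrix.trace_sub]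
    have : (Yᵀ * Xᵀ).trace = (X * Y).trace := by
      rw [← Matrix.transpose_mul, Matrix.trace_transpose]
    rw [this]; ring
  linarith

lemma alt_aux (n : ℕ) (k : ℕ) :
    (∀ X Y : Matrix (Fin n) (Fin n) ℝ, Xᵀ = X → Yᵀ = Y →
      ((X * Y) ^ (2 ^ k)).trace ≤ (X ^ (2 ^ k) * Y ^ (2 ^ k)).trace) ∧
    (∀ A : Matrix (Fin n) (Fin n) ℝ, (A ^ (2 ^ (k + 1))).trace ≤ ((A * Aᵀ) ^ (2 ^ k)).trace) := by
  induction k using Nat.strong_induction_on with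
  | _ k ih =>
    have Q : ∀ X Y : Matrix (Fin n) (Fin n) ℝ, Xᵀ = X → Yᵀ = Y →
        ((X * Y) ^ (2 ^ k)).trace ≤ (X ^ (2 ^ k) * Y ^ (2 ^ k)).trace := by
      intro X Y hX hY
      rcases k with _ | k
      · simp
      · refine ((ih k (Nat.lt_succ_self k)).2 (X * Y)).trans ?_
        have e1 : X * Y * (X * Y)ᵀ = X * (Y * Y * X) := by
          rw [Matrix.transpose_mul, hX, hY]; simp only [Matrix.mul_assoc]
        rw [e1, trace_pow_comm _ _ _ (by positivity)]
        have e2 : Y * Y * X * X = (Y * Y) * (X * X) := by simp only [Matrix.mul_assoc]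
        rw [e2]
        refine ((ih k (Nat.lt_succ_self k)).1 _ _ ?_ ?_).trans ?_
        · rw [Matrix.transpose_mul, hY]
        · rw [Matrix.transpose_mul, hX]
        · rw [← pow_two, ← pow_two, ← pow_mul, ← pow_mul, Matrix.trace_mul_comm, ← pow_succ']
    refine ⟨Q, ?_⟩
    intro A
    rcases k with _ | k
    · have := trace_mul_le A A
      have e : (Aᵀ * A).trace = (A * Aᵀ).trace := Matrix.trace_mul_comm _ _
      simp only [zero_add, pow_one, pow_zero]
      rw [pow_two]; linarith
    · have h1 := (ih k (Nat.lt_succ_self k)).2 (A * A)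
      have h2 : A ^ (2 ^ (k + 1 + 1)) = (A * A) ^ (2 ^ (k + 1)) := by
        rw [← pow_two, ← pow_mul, ← pow_succ']
      rw [h2]
      refine h1.trans ?_
      have e1 : A * A * (A * A)ᵀ = A * (A * Aᵀ * Aᵀ) := by
        rw [Matrix.transpose_mul]; simp only [Matrix.mul_assoc]
      rw [e1, trace_pow_comm _ _ _ (by positivity)]
      have e2 : A * Aᵀ * Aᵀ * A = (A * Aᵀ) * (Aᵀ * A) := by simp only [Matrix.mul_assoc]
      rw [e2]
      have s1 : (A * Aᵀ)ᵀ = A * Aᵀ := by simp [Matrix.transpose_mul]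
      have s2 : (Aᵀ * A)ᵀ = Aᵀ * A := by simp [Matrix.transpose_mul]
      refine ((ih k (Nat.lt_succ_self k)).1 _ _ s1 s2).trans ?_
      refine (trace_mul_le _ _).trans ?_
      rw [Matrix.transpose_pow, Matrix.transpose_pow, s1, s2, ← pow_add, ← pow_add,
        trace_pow_comm Aᵀ A _ (by positivity)]
      rw [pow_succ 2 k]
      have : 2 ^ k * 2 = 2 ^ k + 2 ^ k := by ring
      rw [this]; linarith

lemma alt {n k : ℕ} (X Y : Matrix (Fin n) (Fin n) ℝ) (hX : Xᵀ = X) (hY : Yᵀ = Y) :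
    ((X * Y) ^ (2 ^ k)).trace ≤ (X ^ (2 ^ k) * Y ^ (2 ^ k)).trace := (alt_aux n k).1 X Y hX hY

lemma spectral {n : ℕ} (M : Matrix (Fin n) (Fin n) ℝ) (hM : Mᵀ = M) :
    ∃ (U : Matrix (Fin n) (Fin n) ℝ) (D : Fin n → ℝ), Uᵀ * U = 1 ∧ U * Uᵀ = 1 ∧
      M = U * diagonal D * Uᵀ := by
  have h : M.IsHermitian := by
    rw [Matrix.IsHermitian, Matrix.conjTranspose_eq_transpose_of_trivial, hM]
  refine ⟨h.eigenvectorUnitary, h.eigenvalues, ?_, ?_, ?_⟩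
  · have := Unitary.coe_star_mul_self h.eigenvectorUnitary
    simpa [Matrix.star_eq_conjTranspose, Matrix.conjTranspose_eq_transpose_of_trivial] using this
  · have := Unitary.coe_mul_star_self h.eigenvectorUnitary
    simpa [Matrix.star_eq_conjTranspose, Matrix.conjTranspose_eq_transpose_of_trivial] using this
  · have := h.spectral_theorem
    rw [Unitary.conjStarAlgAut_apply] at this
    simpa [Matrix.star_eq_conjTranspose, Matrix.conjTranspose_eq_transpose_of_trivial] using this

lemma conj_diag_mul {n : ℕ} (U : Matrix (Fin n) (Fin n) ℝ) (hU : Uᵀ * U = 1) (D E : Fin n → ℝ) :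
    (U * diagonal D * Uᵀ) * (U * diagonal E * Uᵀ) = U * diagonal (fun i => D i * E i) * Uᵀ := by
  calc _ = U * diagonal D * (Uᵀ * U) * diagonal E * Uᵀ := by simp only [Matrix.mul_assoc]
    _ = _ := by rw [hU, Matrix.mul_one, Matrix.mul_assoc U, Matrix.diagonal_mul_diagonal]

lemma conj_diag_pow {n : ℕ} (U : Matrix (Fin n) (Fin n) ℝ) (hU : Uᵀ * U = 1) (hU' : U * Uᵀ = 1)
    (D : Fin n → ℝ) (k : ℕ) :
    (U * diagonal D * Uᵀ) ^ k = U * diagonal (fun i => D i ^ k) * Uᵀ := by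
  induction k with
  | zero => simp [hU']
  | succ k ih => rw [pow_succ, ih, conj_diag_mul U hU]; simp only [pow_succ]

lemma conj_diag_trace {n : ℕ} (U : Matrix (Fin n) (Fin n) ℝ) (hU : Uᵀ * U = 1)
    (D : Fin n → ℝ) : (U * diagonal D * Uᵀ).trace = ∑ i, D i := by
  rw [Matrix.trace_mul_comm, ← Matrix.mul_assoc, hU, Matrix.one_mul, Matrix.trace_diagonal]

lemma conj_diag_inv {n : ℕ} (U : Matrix (Fin n) (Fin n) ℝ) (hU : Uᵀ * U = 1) (hU' : U * Uᵀ = 1)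
    (D : Fin n → ℝ) (hD : ∀ i, D i ≠ 0) :
    (U * diagonal D * Uᵀ)⁻¹ = U * diagonal (fun i => (D i)⁻¹) * Uᵀ := by
  apply Matrix.inv_eq_right_inv
  rw [conj_diag_mul U hU]
  simp [hD, hU']

lemma conj_diag_quad {n : ℕ} (U : Matrix (Fin n) (Fin n) ℝ)
    (D : Fin n → ℝ) (v : Fin n → ℝ) :
    v ⬝ᵥ ((U * diagonal D * Uᵀ) *ᵥ v) = ∑ i, D i * ((Uᵀ *ᵥ v) i) ^ 2 := by
  rw [← Matrix.mulVec_mulVec, ← Matrix.mulVec_mulVec, Matrix.dotProduct_mulVec,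
    ← Matrix.mulVec_transpose]
  simp only [dotProduct, Matrix.mulVec_diagonal]
  exact Finset.sum_congr rfl fun i _ => by ring

/-- eigenvector test: quadratic form at column recovers D i -/
lemma conj_diag_col {n : ℕ} (U : Matrix (Fin n) (Fin n) ℝ) (hU : Uᵀ * U = 1)
    (D : Fin n → ℝ) (i : Fin n) :
    (U *ᵥ Pi.single i 1) ⬝ᵥ ((U * diagonal D * Uᵀ) *ᵥ (U *ᵥ Pi.single i 1)) = D i := by
  rw [conj_diag_quad, Matrix.mulVec_mulVec, hU, Matrix.one_mulVec]
  simp [Pi.single_apply]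

lemma col_norm {n : ℕ} (U : Matrix (Fin n) (Fin n) ℝ) (hU : Uᵀ * U = 1) (i : Fin n) :
    (U *ᵥ Pi.single i 1) ⬝ᵥ (U *ᵥ Pi.single i 1) = 1 := by
  rw [Matrix.dotProduct_mulVec, ← Matrix.mulVec_transpose, Matrix.mulVec_mulVec, hU, Matrix.one_mulVec]
  simp

lemma norm_rot {n : ℕ} (U : Matrix (Fin n) (Fin n) ℝ) (hU : U * Uᵀ = 1) (v : Fin n → ℝ) :
    ∑ i, ((Uᵀ *ᵥ v) i) ^ 2 = v ⬝ᵥ v := by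
  have := conj_diag_quad U (fun _ => 1) v
  simp only [Matrix.diagonal_one, Matrix.mul_one, hU, Matrix.one_mulVec, one_mul] at this
  exact this.symm

/-- nonnegativity of the trace of a product of positive semidefinite matrices -/
lemma trace_mul_nonneg {n : ℕ} (P R : Matrix (Fin n) (Fin n) ℝ) (hP : P.PosSemidef)
    (hR : ∀ v, 0 ≤ v ⬝ᵥ (R *ᵥ v)) : 0 ≤ (P * R).trace := by
  obtain ⟨U, D, hU, hU', rfl⟩ := spectral P (by
    have := hP.isHermitian
    rwa [Matrix.IsHermitian, Matrix.conjTranspose_eq_transpose_of_trivial] at this)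
  have hD : ∀ i, 0 ≤ D i := by
    intro i
    have := hP.dotProduct_mulVec_nonneg (U *ᵥ Pi.single i 1)
    rw [star_trivial, conj_diag_col U hU] at this
    exact this
  have : (U * diagonal D * Uᵀ * R).trace = ∑ i, D i * ((U *ᵥ Pi.single i 1) ⬝ᵥ (R *ᵥ (U *ᵥ Pi.single i 1))) := by
    have e : (U * diagonal D * Uᵀ * R).trace = (diagonal D * (Uᵀ * R * U)).trace := by
      rw [Matrix.mul_assoc, Matrix.mul_assoc, Matrix.trace_mul_comm]
      simp only [Matrix.mul_assoc]
    rw [e, Matrix.trace]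
    refine Finset.sum_congr rfl fun i _ => ?_
    rw [Matrix.diag_apply, Matrix.diagonal_mul]
    congr 1
    rw [← Matrix.vecMul_transpose, ← Matrix.dotProduct_mulVec, Matrix.vecMul_transpose,
      Matrix.mulVec_mulVec, Matrix.mulVec_mulVec]
    simp [Matrix.mul_assoc]
  rw [this]
  exact Finset.sum_nonneg fun i _ => mul_nonneg (hD i) (hR _)

lemma psd_symm {n : ℕ} {P : Matrix (Fin n) (Fin n) ℝ} (hP : P.PosSemidef) : Pᵀ = P := by
  have := hP.isHermitian
  rwa [Matrix.IsHermitian, Matrix.conjTranspose_eq_transpose_of_trivial] at this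

lemma psd_mk {n : ℕ} {P : Matrix (Fin n) (Fin n) ℝ} (h : Pᵀ = P)
    (h2 : ∀ v, 0 ≤ v ⬝ᵥ (P *ᵥ v)) : P.PosSemidef := by
  refine Matrix.PosSemidef.of_dotProduct_mulVec_nonneg ?_ (by simpa using h2)
  rw [Matrix.IsHermitian, Matrix.conjTranspose_eq_transpose_of_trivial, h]

lemma pd_mk {n : ℕ} {P : Matrix (Fin n) (Fin n) ℝ} (h : Pᵀ = P)
    (h2 : ∀ v, v ≠ 0 → 0 < v ⬝ᵥ (P *ᵥ v)) : P.PosDef := by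
  refine Matrix.PosDef.of_dotProduct_mulVec_pos ?_ (by simpa using h2)
  rw [Matrix.IsHermitian, Matrix.conjTranspose_eq_transpose_of_trivial, h]

lemma psd_quad {n : ℕ} {P : Matrix (Fin n) (Fin n) ℝ} (hP : P.PosSemidef) (v : Fin n → ℝ) :
    0 ≤ v ⬝ᵥ (P *ᵥ v) := by
  simpa using hP.dotProduct_mulVec_nonneg v

lemma pd_quad {n : ℕ} {P : Matrix (Fin n) (Fin n) ℝ} (hP : P.PosDef) (v : Fin n → ℝ) (hv : v ≠ 0) :
    0 < v ⬝ᵥ (P *ᵥ v) := by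
  simpa using hP.dotProduct_mulVec_pos hv

lemma quad_conj {n m : ℕ} (B : Matrix (Fin n) (Fin m) ℝ) (H : Matrix (Fin n) (Fin n) ℝ) (v : Fin m → ℝ) :
    v ⬝ᵥ ((Bᵀ * H * B) *ᵥ v) = (B *ᵥ v) ⬝ᵥ (H *ᵥ (B *ᵥ v)) := by
  rw [← Matrix.mulVec_mulVec, ← Matrix.mulVec_mulVec, Matrix.dotProduct_mulVec, Matrix.vecMul_transpose]

/-- spectral decomposition of a positive definite matrix -/
lemma spectral_pd {n : ℕ} {V : Matrix (Fin n) (Fin n) ℝ} (hV : V.PosDef) :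
    ∃ (U : Matrix (Fin n) (Fin n) ℝ) (D : Fin n → ℝ), Uᵀ * U = 1 ∧ U * Uᵀ = 1 ∧
      V = U * diagonal D * Uᵀ ∧ ∀ i, 0 < D i := by
  obtain ⟨U, D, hU, hU', e⟩ := spectral V (psd_symm hV.posSemidef)
  refine ⟨U, D, hU, hU', e, fun i => ?_⟩
  have h := pd_quad hV (U *ᵥ Pi.single i 1) (by
    intro h0
    have := col_norm U hU i
    rw [h0] at this; simp at this)
  rwa [e, conj_diag_col U hU] at h

/-- factorization of the inverse -/
lemma factor_inv {n : ℕ} {V : Matrix (Fin n) (Fin n) ℝ} (hV : V.PosDef) :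
    ∃ B : Matrix (Fin n) (Fin n) ℝ, V⁻¹ = B * Bᵀ ∧ Bᵀ * V * B = 1 := by
  obtain ⟨U, D, hU, hU', e, hD⟩ := spectral_pd hV
  refine ⟨U * diagonal (fun i => (√(D i))⁻¹) * Uᵀ, ?_, ?_⟩
  · have t : (U * diagonal (fun i => (√(D i))⁻¹) * Uᵀ)ᵀ = U * diagonal (fun i => (√(D i))⁻¹) * Uᵀ := by
      simp [Matrix.transpose_mul, Matrix.mul_assoc]
    rw [t, e, conj_diag_inv U hU hU' D (fun i => (hD i).ne'), conj_diag_mul U hU]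
    congr 3
    funext i
    rw [← mul_inv, Real.mul_self_sqrt (hD i).le]
  · have t : (U * diagonal (fun i => (√(D i))⁻¹) * Uᵀ)ᵀ = U * diagonal (fun i => (√(D i))⁻¹) * Uᵀ := by
      simp [Matrix.transpose_mul, Matrix.mul_assoc]
    rw [t, e, conj_diag_mul U hU, conj_diag_mul U hU]
    have : (fun i => (√(D i))⁻¹ * D i * (√(D i))⁻¹) = fun _ => (1:ℝ) := by
      funext i
      have h := Real.mul_self_sqrt (hD i).le
      have h2 : √(D i) ≠ 0 := (Real.sqrt_pos.2 (hD i)).ne'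
      field_simp
      nlinarith
    rw [this]; simp [hU']

lemma scal_ineq (q : ℕ) (r : ℝ) (hr : 0 ≤ r) (h : q * r ≤ 1) :
    ((1 + r)⁻¹) ^ q ≤ 1 - q / 2 * r := by
  have hb : 1 + q * r ≤ (1 + r) ^ q := one_add_mul_le_pow (by linarith) q
  have h0 : 0 ≤ q * r := by positivity
  rw [inv_pow]
  calc ((1 + r) ^ q)⁻¹ ≤ (1 + q * r)⁻¹ := inv_anti₀ (by linarith) hb
    _ ≤ _ := by
      rw [inv_le_iff_one_le_mul₀ (by linarith)]
      nlinarith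

lemma pow_bound {n : ℕ} (Q : Matrix (Fin n) (Fin n) ℝ) (hQ : Q.PosSemidef) (q : ℕ)
    (h : ∀ v, q * (v ⬝ᵥ (Q *ᵥ v)) ≤ v ⬝ᵥ v) (v : Fin n → ℝ) :
    0 ≤ v ⬝ᵥ ((1 - ((q:ℝ) / 2) • Q - ((1 + Q)⁻¹) ^ q) *ᵥ v) := by
  obtain ⟨U, D, hU, hU', e⟩ := spectral Q (psd_symm hQ)
  have hD : ∀ i, 0 ≤ D i := by
    intro i
    have := psd_quad hQ (U *ᵥ Pi.single i 1)
    rwa [e, conj_diag_col U hU] at this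
  have hq : ∀ i, q * D i ≤ 1 := by
    intro i
    have := h (U *ᵥ Pi.single i 1)
    rwa [e, conj_diag_col U hU, col_norm U hU] at this
  have e1 : (1 + Q) = U * diagonal (fun i => 1 + D i) * Uᵀ := by
    have : diagonal (fun i => 1 + D i) = 1 + diagonal D := by
      rw [← Matrix.diagonal_one, Matrix.diagonal_add]
    rw [this, Matrix.mul_add, Matrix.add_mul, Matrix.mul_one, hU', ← e]
  rw [Matrix.sub_mulVec, Matrix.sub_mulVec, Matrix.one_mulVec, dotProduct_sub, dotProduct_sub,
    Matrix.smul_mulVec, dotProduct_smul, e1, conj_diag_inv U hU hU' _ (fun i => by linarith [hD i]), conj_diag_pow U hU hU',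
    conj_diag_quad, e, conj_diag_quad, ← norm_rot U hU' v, smul_eq_mul, Finset.mul_sum,
    ← Finset.sum_sub_distrib, ← Finset.sum_sub_distrib]
  refine Finset.sum_nonneg fun i _ => ?_
  have := scal_ineq q (D i) (hD i) (hq i)
  nlinarith [sq_nonneg ((Uᵀ *ᵥ v) i)]

/-- one step of the potential -/
lemma one_step {n : ℕ} (k : ℕ) (V H : Matrix (Fin n) (Fin n) ℝ) (hV : V.PosDef) (hH : H.PosSemidef)
    (h : ∀ v, ((2 ^ k : ℕ) : ℝ) * (v ⬝ᵥ (H *ᵥ v)) ≤ v ⬝ᵥ (V *ᵥ v)) :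
    (((V + H)⁻¹) ^ (2 ^ k)).trace ≤ ((V⁻¹) ^ (2 ^ k)).trace
      - ((2 ^ k : ℕ) : ℝ) / 2 * ((V⁻¹) ^ (2 ^ k + 1) * H).trace := by
  obtain ⟨B, hB, hB1⟩ := factor_inv hV
  set q := 2 ^ k with hq
  have hqpos : 0 < q := by positivity
  set Q := Bᵀ * H * B with hQ
  have hQp : Q.PosSemidef := by
    have := hH.conjTranspose_mul_mul_same B
    rwa [Matrix.conjTranspose_eq_transpose_of_trivial] at this
  have hQ1 : (1 + Q).PosDef := Matrix.PosDef.one.add_posSemidef hQp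
  have u1 : IsUnit (1 + Q).det := (Matrix.isUnit_iff_isUnit_det _).1 hQ1.isUnit
  have BL : B * (Bᵀ * V) = 1 := by
    rw [← Matrix.mul_assoc, ← hB]
    exact Matrix.nonsing_inv_mul _ ((Matrix.isUnit_iff_isUnit_det _).1 hV.isUnit)
  have VB : V * B * Bᵀ = 1 := by
    rw [Matrix.mul_assoc, ← hB]
    exact Matrix.mul_nonsing_inv _ ((Matrix.isUnit_iff_isUnit_det _).1 hV.isUnit)
  have inv : (V + H)⁻¹ = B * ((1 + Q)⁻¹ * Bᵀ) := by
    apply Matrix.inv_eq_right_inv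
    have : (V + H) * B = V * B * (1 + Q) := by
      rw [Matrix.mul_add, Matrix.mul_one, Matrix.add_mul, hQ]
      congr 1
      calc H * B = (V * B * Bᵀ) * H * B := by rw [VB, Matrix.one_mul]
        _ = _ := by simp only [Matrix.mul_assoc]
    rw [← Matrix.mul_assoc, this, Matrix.mul_assoc, ← Matrix.mul_assoc (1 + Q), Matrix.mul_nonsing_inv _ u1,
      Matrix.one_mul, VB]
  have sY : ((1 + Q)⁻¹)ᵀ = (1 + Q)⁻¹ := by
    rw [Matrix.transpose_nonsing_inv, Matrix.transpose_add, Matrix.transpose_one, psd_symm hQp]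
  have sB : (Bᵀ * B)ᵀ = Bᵀ * B := by simp [Matrix.transpose_mul]
  have pB : (Bᵀ * B).PosSemidef := by
    have := Matrix.posSemidef_conjTranspose_mul_self B
    rwa [Matrix.conjTranspose_eq_transpose_of_trivial] at this
  have step1 : (((V + H)⁻¹) ^ q).trace ≤ ((Bᵀ * B) ^ q * ((1 + Q)⁻¹) ^ q).trace := by
    rw [inv, trace_pow_comm _ _ _ hqpos, Matrix.mul_assoc, trace_pow_comm _ _ _ hqpos]
    exact alt _ _ sB sY
  have step2 : 0 ≤ ((Bᵀ * B) ^ q * (1 - ((q:ℝ) / 2) • Q - ((1 + Q)⁻¹) ^ q)).trace := by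
    apply trace_mul_nonneg _ _ (pB.pow q)
    apply pow_bound Q hQp q
    intro v
    rw [hQ, quad_conj]
    refine (h _).trans ?_
    rw [← quad_conj, hB1, Matrix.one_mulVec]
  have e3 : ((Bᵀ * B) ^ q * Q).trace = ((V⁻¹) ^ (q + 1) * H).trace := by
    have : (V⁻¹) ^ (q + 1) = B * (Bᵀ * B) ^ q * Bᵀ := by
      rw [hB]
      have h : ∀ j : ℕ, (B * Bᵀ) ^ (j + 1) = B * (Bᵀ * B) ^ j * Bᵀ := by
        intro j
        induction j with
        | zero => simp
        | succ j ih => rw [pow_succ, ih, pow_succ]; simp only [Matrix.mul_assoc]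
      exact h q
    rw [this, hQ, ← Matrix.mul_assoc, Matrix.trace_mul_comm]
    simp only [Matrix.mul_assoc]
  have e4 : ((Bᵀ * B) ^ q).trace = ((V⁻¹) ^ q).trace := by
    rw [hB, trace_pow_comm _ _ _ hqpos]
  rw [Matrix.mul_sub, Matrix.mul_sub, Matrix.mul_one, Matrix.mul_smul, Matrix.trace_sub,
    Matrix.trace_sub, Matrix.trace_smul, e3, e4, smul_eq_mul] at step2
  linarith

/-- traces of powers -/
lemma trace_scal {n : ℕ} (V : Matrix (Fin n) (Fin n) ℝ) (hV : V.PosDef) (q : ℕ) (b : ℝ) (hb : 0 < b) :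
    (((V⁻¹) ^ q).trace - n * (b⁻¹) ^ q) / b ≤ ((V⁻¹) ^ (q + 1)).trace := by
  obtain ⟨U, D, hU, hU', e, hD⟩ := spectral_pd hV
  rw [e, conj_diag_inv U hU hU' D (fun i => (hD i).ne'), conj_diag_pow U hU hU', conj_diag_pow U hU hU',
    conj_diag_trace U hU, conj_diag_trace U hU, div_le_iff₀ hb, Finset.sum_mul]
  have : (n:ℝ) * (b⁻¹) ^ q = ∑ i : Fin n, (b⁻¹) ^ q := by simp
  rw [this, ← Finset.sum_sub_distrib]
  refine Finset.sum_le_sum fun i _ => ?_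
  set w := (D i)⁻¹ with hw
  have hw0 : 0 < w := inv_pos.2 (hD i)
  rw [pow_succ]
  by_cases hc : 1 ≤ w * b
  · have : 0 < w ^ q := by positivity
    have : 0 < (b⁻¹) ^ q := by positivity
    nlinarith
  · push Not at hc
    have h1 : w ≤ b⁻¹ := by rw [← one_div, le_div_iff₀ hb]; exact hc.le
    have h2 : w ^ q ≤ (b⁻¹) ^ q := pow_le_pow_left₀ hw0.le h1 q
    have : 0 < w ^ q * w * b := by positivity
    linarith

lemma trace_nonneg' {n : ℕ} (V : Matrix (Fin n) (Fin n) ℝ) (hV : V.PosDef) (q : ℕ) :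
    0 ≤ ((V⁻¹) ^ q).trace := (hV.posSemidef.inv.pow q).trace_nonneg

lemma trace_lower {n : ℕ} (V : Matrix (Fin n) (Fin n) ℝ) (hV : V.PosDef) (q : ℕ) (b : ℝ)
    (hb : 0 < b) (h : ((V⁻¹) ^ q).trace < (b⁻¹) ^ q) (v : Fin n → ℝ) :
    b * (v ⬝ᵥ v) ≤ v ⬝ᵥ (V *ᵥ v) := by
  obtain ⟨U, D, hU, hU', e, hD⟩ := spectral_pd hV
  rw [e, conj_diag_inv U hU hU' D (fun i => (hD i).ne'), conj_diag_pow U hU hU', 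
    conj_diag_trace U hU] at h
  rw [e, conj_diag_quad, ← norm_rot U hU' v, Finset.mul_sum]
  refine Finset.sum_le_sum fun i _ => ?_
  refine mul_le_mul_of_nonneg_right ?_ (sq_nonneg _)
  have h1 : ((D i)⁻¹) ^ q ≤ ∑ i, ((D i)⁻¹) ^ q :=
    Finset.single_le_sum (f := fun i => ((D i)⁻¹) ^ q) (fun j _ => by have := hD j; positivity) (Finset.mem_univ i)
  have h2 := lt_of_pow_lt_pow_left₀ q (by positivity) (h1.trans_lt h)
  exact ((inv_lt_inv₀ (hD i) hb).1 h2).le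

lemma trace_smul_one {n : ℕ} (c : ℝ) (hc : c ≠ 0) (q : ℕ) :
    (((c • (1 : Matrix (Fin n) (Fin n) ℝ))⁻¹) ^ q).trace = n * (c⁻¹) ^ q := by
  have : (c • (1 : Matrix (Fin n) (Fin n) ℝ))⁻¹ = c⁻¹ • 1 := by
    apply Matrix.inv_eq_right_inv
    simp [hc, smul_smul]
  rw [this, smul_pow, one_pow, Matrix.trace_smul, Matrix.trace_one]
  simp [mul_comm]

end E2TC

open MeasureTheory Matrix Real
open scoped ENNReal

namespace E2TC

lemma meas_inv {Ω : Type*} [MeasurableSpace Ω] {d : ℕ} {M : Ω → Matrix (Fin d) (Fin d) ℝ}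
    (hM : ∀ i j, Measurable fun x => M x i j) (i j : Fin d) : Measurable fun x => (M x)⁻¹ i j := by
  have hdet : ∀ {N : Ω → Matrix (Fin d) (Fin d) ℝ}, (∀ i j, Measurable fun x => N x i j) →
      Measurable fun x => (N x).det := by
    intro N hN
    simp only [Matrix.det_apply]
    refine Finset.measurable_sum _ fun σ _ => ?_
    exact (Finset.measurable_prod _ fun i _ => hN _ _).const_smul _
  simp only [Matrix.inv_def, Matrix.smul_apply, Ring.inverse_eq_inv', smul_eq_mul, Matrix.adjugate_apply]
  refine (hdet hM).inv.mul (hdet ?_)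
  intro a b
  by_cases h : a = j
  · subst h; simp
  · simp only [Matrix.updateRow_ne h]; exact hM a b

lemma meas_mul {Ω : Type*} [MeasurableSpace Ω] {a b c : ℕ} {M : Ω → Matrix (Fin a) (Fin b) ℝ}
    {N : Ω → Matrix (Fin b) (Fin c) ℝ}
    (hM : ∀ i j, Measurable fun x => M x i j) (hN : ∀ i j, Measurable fun x => N x i j) (i : Fin a) (j : Fin c) :
    Measurable fun x => (M x * N x) i j := by
  simp only [Matrix.mul_apply]
  exact Finset.measurable_sum _ fun k _ => (hM i k).mul (hN k j)

lemma meas_pow {Ω : Type*} [MeasurableSpace Ω] {d : ℕ} {M : Ω → Matrix (Fin d) (Fin d) ℝ}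
    (hM : ∀ i j, Measurable fun x => M x i j) (q : ℕ) (i j : Fin d) : Measurable fun x => (M x ^ q) i j := by
  induction q generalizing i j with
  | zero => simp only [pow_zero]; exact measurable_const
  | succ q ih => simp only [pow_succ]; exact meas_mul ih hM i j

lemma meas_trace {Ω : Type*} [MeasurableSpace Ω] {d : ℕ} {M : Ω → Matrix (Fin d) (Fin d) ℝ}
    (hM : ∀ i j, Measurable fun x => M x i j) : Measurable fun x => (M x).trace := by
  simp only [Matrix.trace, Matrix.diag_apply]
  exact Finset.measurable_sum _ fun k _ => hM k k

lemma meas_mulVec {Ω : Type*} [MeasurableSpace Ω] {a b : ℕ} {M : Ω → Matrix (Fin a) (Fin b) ℝ}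
    {v : Ω → Fin b → ℝ}
    (hM : ∀ i j, Measurable fun x => M x i j) (hv : ∀ i, Measurable fun x => v x i) (i : Fin a) :
    Measurable fun x => (M x *ᵥ v x) i := by
  simp only [Matrix.mulVec, dotProduct]
  exact Finset.measurable_sum _ fun k _ => (hM i k).mul (hv k)

lemma meas_dot {Ω : Type*} [MeasurableSpace Ω] {a : ℕ} {u v : Ω → Fin a → ℝ}
    (hu : ∀ i, Measurable fun x => u x i) (hv : ∀ i, Measurable fun x => v x i) :
    Measurable fun x => u x ⬝ᵥ v x := by
  simp only [dotProduct]
  exact Finset.measurable_sum _ fun k _ => (hu k).mul (hv k)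

section pot
variable {X : Type*} [MeasurableSpace X] (DX : Measure X) [IsProbabilityMeasure DX] {d : ℕ}
  (H : X → Matrix (Fin d) (Fin d) ℝ) (k : ℕ) (D b : ℝ)

lemma integral_affine {g : X → ℝ} (hg : Integrable g DX) (a c : ℝ) :
    ∫ x, (a + c * g x) ∂DX = a + c * ∫ x, g x ∂DX := by
  rw [integral_add (integrable_const _) (hg.const_mul _), integral_const_mul]
  simp

lemma integral_trace (hint : ∀ i j, Integrable (fun x => H x i j) DX)
    (hmean : ∀ i j, ∫ x, H x i j ∂DX = (1 : Matrix (Fin d) (Fin d) ℝ) i j)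
    (W : Matrix (Fin d) (Fin d) ℝ) :
    Integrable (fun x => (W * H x).trace) DX ∧ ∫ x, (W * H x).trace ∂DX = W.trace := by
  have e : ∀ x, (W * H x).trace = ∑ i, ∑ j, W i j * H x j i := by
    intro x; simp [Matrix.trace, Matrix.mul_apply]
  simp only [e]
  constructor
  · exact integrable_finsetSum _ fun i _ => integrable_finsetSum _ fun j _ => (hint j i).const_mul _
  · have e1 := integral_finsetSum (μ := DX) Finset.univ (f := fun i x => ∑ j, W i j * H x j i)
      (fun i _ => integrable_finsetSum _ fun j _ => (hint j i).const_mul _)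
    rw [e1]
    have : ∀ i, ∫ x, ∑ j, W i j * H x j i ∂DX = W i i := by
      intro i
      have e2 := integral_finsetSum (μ := DX) Finset.univ (f := fun j x => W i j * H x j i)
        (fun j _ => (hint j i).const_mul _)
      rw [e2]
      simp only [integral_const_mul, hmean]
      simp [Matrix.one_apply]
    simp only [this, Matrix.trace, Matrix.diag_apply]

lemma pot_bound (hm : ∀ i j, Measurable fun x => H x i j)
    (hint : ∀ i j, Integrable (fun x => H x i j) DX)
    (hmean : ∀ i j, ∫ x, H x i j ∂DX = (1 : Matrix (Fin d) (Fin d) ℝ) i j)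
    (hpsd : ∀ x, (H x).PosSemidef) (hD : ∀ x v, v ⬝ᵥ (H x *ᵥ v) ≤ D * (v ⬝ᵥ v))
    (hb : 0 < b) (hq : ((2 ^ k : ℕ) : ℝ) / (2 * b) ≤ 1) (n : ℕ) :
    ∀ V : Matrix (Fin d) (Fin d) ℝ, V.PosDef →
      (∀ v, ((2 ^ k : ℕ) : ℝ) * (D * (v ⬝ᵥ v)) ≤ v ⬝ᵥ (V *ᵥ v)) →
      ∫⁻ x : Fin n → X, ENNReal.ofReal (((V + ∑ i, H (x i))⁻¹ ^ (2 ^ k)).trace) ∂(Measure.pi fun _ => DX)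
        ≤ ENNReal.ofReal ((1 - ((2 ^ k : ℕ) : ℝ) / (2 * b)) ^ n * ((V⁻¹) ^ (2 ^ k)).trace
          + (1 - (1 - ((2 ^ k : ℕ) : ℝ) / (2 * b)) ^ n) * (d * (b⁻¹) ^ (2 ^ k))) := by
  set q := 2 ^ k with hqd
  set ρ := 1 - (q : ℝ) / (2 * b) with hρ
  have hρ0 : 0 ≤ ρ := by linarith
  have hρ1 : ρ ≤ 1 := by
    have : 0 ≤ (q : ℝ) / (2 * b) := by positivity
    linarith
  induction n with
  | zero =>
    intro V hV hVD
    simp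
  | succ n ih =>
    intro V hV hVD
    have hVH : ∀ x, (V + H x).PosDef := fun x => hV.add_posSemidef (hpsd x)
    have mp := (measurePreserving_piFinSuccAbove (fun _ : Fin (n+1) => DX) 0).symm
    rw [← mp.lintegral_comp_emb (MeasurableEquiv.measurableEmbedding _)]
    have hmeas : Measurable fun p : X × (Fin n → X) =>
        ENNReal.ofReal (((V + (H p.1 + ∑ i, H (p.2 i)))⁻¹ ^ q).trace) := by
      apply ENNReal.measurable_ofReal.comp
      apply meas_trace
      apply meas_pow
      apply meas_inv
      intro i j
      simp only [Matrix.add_apply, Matrix.sum_apply]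
      refine measurable_const.add (((hm i j).comp measurable_fst).add ?_)
      exact Finset.measurable_sum _ fun t _ =>
        (hm i j).comp ((measurable_pi_apply t).comp measurable_snd)
    have e : ∀ p : X × (Fin n → X), ∑ i, H (((MeasurableEquiv.piFinSuccAbove (fun _ : Fin (n+1) => X) 0).symm p) i)
        = H p.1 + ∑ i, H (p.2 i) := by
      intro p
      rw [Fin.sum_univ_succ]
      simp [MeasurableEquiv.piFinSuccAbove]
    simp only [e]
    rw [lintegral_prod _ hmeas.aemeasurable]
    have hρn : 0 ≤ ρ ^ n := by positivity
    have hρn1 : ρ ^ n ≤ 1 := pow_le_one₀ hρ0 hρ1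
    have hI := integral_trace DX H hint hmean ((V⁻¹) ^ (q + 1))
    have step : ∀ x, (((V + H x)⁻¹) ^ q).trace ≤ ((V⁻¹) ^ q).trace
      - (q : ℝ) / 2 * ((V⁻¹) ^ (q + 1) * H x).trace := by
      intro x
      refine one_step k V (H x) hV (hpsd x) fun v => le_trans ?_ (hVD v)
      exact mul_le_mul_of_nonneg_left (hD x v) (by positivity)
    set e0 : ℝ := d * (b⁻¹) ^ q with he0
    have he0' : 0 ≤ e0 := by positivity
    have hint2 : Integrable (fun x => ρ ^ n * (((V⁻¹) ^ q).trace
      - (q : ℝ) / 2 * ((V⁻¹) ^ (q + 1) * H x).trace) + (1 - ρ ^ n) * e0) DX :=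
      (((integrable_const _).sub (hI.1.const_mul _)).const_mul _).add (integrable_const _)
    calc ∫⁻ x, ∫⁻ y : Fin n → X, ENNReal.ofReal (((V + (H x + ∑ i, H (y i)))⁻¹ ^ q).trace)
            ∂(Measure.pi fun _ => DX) ∂DX
        ≤ ∫⁻ x, ENNReal.ofReal (ρ ^ n * (((V + H x)⁻¹) ^ q).trace + (1 - ρ ^ n) * e0) ∂DX := by
          refine lintegral_mono fun x => ?_
          simp only [← add_assoc]
          refine ih (V + H x) (hVH x) fun v => (hVD v).trans ?_
          rw [Matrix.add_mulVec, dotProduct_add]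
          linarith [psd_quad (hpsd x) v]
      _ ≤ ∫⁻ x, ENNReal.ofReal (ρ ^ n * (((V⁻¹) ^ q).trace
            - (q : ℝ) / 2 * ((V⁻¹) ^ (q + 1) * H x).trace) + (1 - ρ ^ n) * e0) ∂DX := by
          refine lintegral_mono fun x => ENNReal.ofReal_le_ofReal ?_
          gcongr
          exact step x
      _ = ENNReal.ofReal (∫ x, (ρ ^ n * (((V⁻¹) ^ q).trace
            - (q : ℝ) / 2 * ((V⁻¹) ^ (q + 1) * H x).trace) + (1 - ρ ^ n) * e0) ∂DX) := by
          rw [ofReal_integral_eq_lintegral_ofReal hint2]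
          refine Filter.Eventually.of_forall fun x => ?_
          have h1 := step x
          have h2 := trace_nonneg' _ (hVH x) q
          have : 0 ≤ 1 - ρ ^ n := by linarith
          have h3 := h2.trans h1
          exact add_nonneg (mul_nonneg hρn h3) (mul_nonneg this he0')
      _ ≤ _ := by
          apply ENNReal.ofReal_le_ofReal
          have e9 : ∀ x, ρ ^ n * (((V⁻¹) ^ q).trace
            - (q : ℝ) / 2 * ((V⁻¹) ^ (q + 1) * H x).trace) + (1 - ρ ^ n) * e0
            = (ρ ^ n * ((V⁻¹) ^ q).trace + (1 - ρ ^ n) * e0) +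
              (-(ρ ^ n * ((q : ℝ) / 2))) * ((V⁻¹) ^ (q + 1) * H x).trace := fun x => by ring
          simp only [e9]
          rw [integral_affine DX hI.1, hI.2]
          have h3 := trace_scal V hV q b hb
          rw [← he0] at h3
          have h4 : ((V⁻¹) ^ q).trace - (q : ℝ) / 2 * ((V⁻¹) ^ (q + 1)).trace
              ≤ ρ * ((V⁻¹) ^ q).trace + (1 - ρ) * e0 := by
            have h5 := mul_le_mul_of_nonneg_left h3 (show (0:ℝ) ≤ (q:ℝ) / 2 by positivity)
            have e6 : (q:ℝ) / 2 * ((((V⁻¹) ^ q).trace - e0) / b)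
              = (1 - ρ) * (((V⁻¹) ^ q).trace - e0) := by
              rw [hρ]; field_simp; ring
            rw [e6] at h5
            linarith
          have := mul_le_mul_of_nonneg_left h4 hρn
          rw [pow_succ ρ n]
          nlinarith

/-- lower tail for sums of iid psd matrices with mean one -/
lemma lower_tail (hm : ∀ i j, Measurable fun x => H x i j)
    (hint : ∀ i j, Integrable (fun x => H x i j) DX)
    (hmean : ∀ i j, ∫ x, H x i j ∂DX = (1 : Matrix (Fin d) (Fin d) ℝ) i j)
    (hpsd : ∀ x, (H x).PosSemidef) (hD : ∀ x v, v ⬝ᵥ (H x *ᵥ v) ≤ D * (v ⬝ᵥ v))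
    (n : ℕ) (hn : 0 < n) (hD1 : 1 ≤ D) (hqn : ((2 ^ k : ℕ) : ℝ) * D ≤ n / 16) :
    (Measure.pi fun _ : Fin n => DX) {x | ¬ ∀ v, (n / 16 : ℝ) * (v ⬝ᵥ v) ≤ v ⬝ᵥ ((∑ i, H (x i)) *ᵥ v)}
      ≤ ENNReal.ofReal (2 * d * (2⁻¹ : ℝ) ^ (2 ^ k)) := by
  set q := 2 ^ k with hqd
  have hn' : (0:ℝ) < n := by exact_mod_cast hn
  have hqn1 : (q:ℝ) ≤ n / 16 := by
    have : (0:ℝ) ≤ q := by positivity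
    nlinarith
  set V : Matrix (Fin d) (Fin d) ℝ := (n / 16 : ℝ) • 1 with hV
  have hVp : V.PosDef := Matrix.PosDef.one.smul (by positivity)
  have hVq : ∀ v : Fin d → ℝ, v ⬝ᵥ (V *ᵥ v) = n / 16 * (v ⬝ᵥ v) := by
    intro v; rw [hV, Matrix.smul_mulVec, Matrix.one_mulVec, dotProduct_smul, smul_eq_mul]
  have hvv : ∀ v : Fin d → ℝ, 0 ≤ v ⬝ᵥ v := fun v => by
    simpa [dotProduct] using Finset.sum_nonneg fun i _ => mul_self_nonneg (v i)
  have hb : (0:ℝ) < n / 4 := by positivity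
  have hq1 : (q : ℝ) / (2 * (n / 4)) ≤ 1 := by
    rw [div_le_one (by positivity)]; linarith
  have key := pot_bound DX H k D (n / 4) hm hint hmean hpsd hD hb hq1 n V hVp (fun v => by
    rw [hVq, ← mul_assoc]
    exact mul_le_mul_of_nonneg_right hqn (hvv v))
  rw [← hqd, hV, trace_smul_one _ (by positivity), ← hV] at key
  have hmeas : Measurable fun x : Fin n → X => ENNReal.ofReal (((V + ∑ i, H (x i))⁻¹ ^ q).trace) := by
    apply ENNReal.measurable_ofReal.comp
    apply meas_trace
    apply meas_pow
    apply meas_inv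
    intro i j
    simp only [Matrix.add_apply, Matrix.sum_apply]
    exact measurable_const.add (Finset.measurable_sum _ fun t _ => (hm i j).comp (measurable_pi_apply t))
  set c : ℝ := ((n / 8 : ℝ)⁻¹) ^ q with hc
  have hc0 : 0 < c := by positivity
  have sub : {x : Fin n → X | ¬ ∀ v, (n / 16 : ℝ) * (v ⬝ᵥ v) ≤ v ⬝ᵥ ((∑ i, H (x i)) *ᵥ v)}
      ⊆ {x | ENNReal.ofReal c ≤ ENNReal.ofReal (((V + ∑ i, H (x i))⁻¹ ^ q).trace)} := by
    intro x hx
    by_contra hcon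
    apply hx
    intro v
    have hcon2 : ((V + ∑ i, H (x i))⁻¹ ^ q).trace < c := by
      by_contra h
      exact hcon (ENNReal.ofReal_le_ofReal (not_lt.1 h))
    have hp : (V + ∑ i, H (x i)).PosDef :=
      hVp.add_posSemidef (Matrix.posSemidef_sum _ fun i _ => hpsd _)
    have := trace_lower _ hp q (n / 8) (by positivity) hcon2 v
    rw [Matrix.add_mulVec, dotProduct_add, hVq] at this
    linarith
  refine (measure_mono sub).trans ?_
  refine (meas_ge_le_lintegral_div hmeas.aemeasurable (by simpa using hc0) ENNReal.ofReal_ne_top).trans ?_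
  refine (ENNReal.div_le_div_right key _).trans ?_
  rw [← ENNReal.ofReal_div_of_pos hc0]
  apply ENNReal.ofReal_le_ofReal
  rw [div_le_iff₀ hc0]
  set ρ : ℝ := 1 - (q : ℝ) / (2 * (n / 4)) with hρ
  have hρ0 : 0 ≤ ρ := by linarith
  have hρn : ρ ^ n ≤ Real.exp (-2 * q) := by
    have h1 : ρ ≤ Real.exp (-((q : ℝ) / (2 * (n / 4)))) := by
      have := Real.add_one_le_exp (-((q : ℝ) / (2 * (n / 4))))
      linarith
    refine (pow_le_pow_left₀ hρ0 h1 n).trans ?_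
    rw [← Real.exp_nat_mul]
    apply Real.exp_le_exp.2
    have : (n:ℝ) * (-((q : ℝ) / (2 * (n / 4)))) = -2 * q := by field_simp; ring
    rw [this]
  have hexp : Real.exp (-2 * q) ≤ (4⁻¹ : ℝ) ^ q := by
    have : Real.exp (-2 * q) = (Real.exp (-2)) ^ q := by rw [← Real.exp_nat_mul]; ring_nf
    rw [this]
    refine pow_le_pow_left₀ (Real.exp_pos _).le ?_ q
    rw [Real.exp_neg]
    refine inv_anti₀ (by norm_num) ?_
    have h2 : Real.exp 2 = Real.exp 1 * Real.exp 1 := by rw [← Real.exp_add]; norm_num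
    have := Real.exp_one_gt_d9
    rw [h2]; nlinarith
  have t1 : (n / 16 : ℝ)⁻¹ ^ q = 2 ^ q * c := by
    rw [hc, ← mul_pow]; congr 1; field_simp; norm_num
  have t2 : (n / 4 : ℝ)⁻¹ ^ q = 2⁻¹ ^ q * c := by
    rw [hc, ← mul_pow]; congr 1; field_simp; norm_num
  rw [t1, t2]
  have t3 : (4⁻¹ : ℝ) ^ q * 2 ^ q = 2⁻¹ ^ q := by
    rw [← mul_pow]; norm_num
  have h5 : ρ ^ n * 2 ^ q ≤ 2⁻¹ ^ q := by
    rw [← t3]; gcongr; exact hρn.trans hexp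
  have h6 : 0 ≤ ρ ^ n := by positivity
  have h7 : (0:ℝ) ≤ 2⁻¹ ^ q := by positivity
  have h8 : (0:ℝ) ≤ d * c := by positivity
  calc ρ ^ n * (d * (2 ^ q * c)) + (1 - ρ ^ n) * (d * (2⁻¹ ^ q * c))
      = (d * c) * (ρ ^ n * 2 ^ q + (1 - ρ ^ n) * 2⁻¹ ^ q) := by ring
    _ ≤ (d * c) * (2⁻¹ ^ q + 2⁻¹ ^ q) := by
      apply mul_le_mul_of_nonneg_left _ h8
      nlinarith
    _ = _ := by ring

end pot
end E2TC

open MeasureTheory Matrix Real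
open scoped ENNReal

namespace E2TC

lemma lint_exp_sum {n : ℕ} {E : Type*} [MeasurableSpace E] (μ : Measure E) [IsProbabilityMeasure μ]
    (h : Fin n → E → ℝ) (hm : ∀ i, Measurable (h i)) :
    ∫⁻ x : Fin n → E, ENNReal.ofReal (Real.exp (∑ i, h i (x i))) ∂(Measure.pi fun _ => μ)
      = ∏ i, ∫⁻ e, ENNReal.ofReal (Real.exp (h i e)) ∂μ := by
  have hm' : ∀ i, Measurable fun e => ENNReal.ofReal (Real.exp (h i e)) := fun i => by
    have := hm i; fun_prop
  have e1 : ∀ x : Fin n → E, ENNReal.ofReal (Real.exp (∑ i, h i (x i)))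
      = ∏ i, ENNReal.ofReal (Real.exp (h i (x i))) := by
    intro x
    rw [Real.exp_sum, ENNReal.ofReal_prod_of_nonneg]
    intro i _; positivity
  simp only [e1]
  have ind : ProbabilityTheory.iIndepFun (fun i (x : Fin n → E) => ENNReal.ofReal (Real.exp (h i (x i))))
      (Measure.pi fun _ => μ) :=
    ProbabilityTheory.iIndepFun_pi (fun i => (hm' i).aemeasurable)
  have := ProbabilityTheory.lintegral_prod_eq_prod_lintegral_of_indepFun Finset.univ _ ind
    (fun i => (hm' i).comp (measurable_pi_apply i))
  rw [this]
  refine Finset.prod_congr rfl fun i _ => ?_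
  exact (measurePreserving_eval (fun _ : Fin n => μ) i).lintegral_comp (hm' i)

lemma scalar_tail {n : ℕ} {X : Type*} [MeasurableSpace X] (μ : Measure X) [IsProbabilityMeasure μ]
    (Z : X → ℝ) (hZ : Measurable Z) (b : ℝ) (hb : 0 < b) (h0 : ∀ x, 0 ≤ Z x) (hZb : ∀ x, Z x ≤ b) (l : ℝ) :
    (Measure.pi fun _ : Fin n => μ) {x | 2 * n * (∫ x, Z x ∂μ) + b * l ≤ ∑ i, Z (x i)}
      ≤ ENNReal.ofReal (Real.exp (-l)) := by
  set m := ∫ x, Z x ∂μ with hm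
  have hint : Integrable Z μ := by
    refine Integrable.of_bound hZ.aestronglyMeasurable b (Filter.Eventually.of_forall fun x => ?_)
    rw [Real.norm_of_nonneg (h0 x)]; exact hZb x
  have h1 : ∫⁻ x, ENNReal.ofReal (Real.exp (Z x / b)) ∂μ ≤ ENNReal.ofReal (Real.exp (2 * m / b)) := by
    calc _ ≤ ∫⁻ x, ENNReal.ofReal (1 + (2 / b) * Z x) ∂μ := by
          refine lintegral_mono fun x => ENNReal.ofReal_le_ofReal ?_
          have y0 : 0 ≤ Z x / b := div_nonneg (h0 x) hb.le
          have y1 : Z x / b ≤ 1 := by rw [div_le_one hb]; exact hZb x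
          have := Real.abs_exp_sub_one_sub_id_le (x := Z x / b) (by rw [abs_of_nonneg y0]; exact y1)
          have h3 := (abs_le.1 this).2
          have : 2 / b * Z x = 2 * (Z x / b) := by ring
          rw [this]; nlinarith
      _ = ENNReal.ofReal (∫ x, (1 + (2 / b) * Z x) ∂μ) := by
          have hi : Integrable (fun x => 1 + (2 / b) * Z x) μ := (integrable_const _).add (hint.const_mul _)
          rw [ofReal_integral_eq_lintegral_ofReal hi]
          refine Filter.Eventually.of_forall fun x => ?_
          have := h0 x
          show 0 ≤ 1 + 2 / b * Z x
          positivity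
      _ ≤ _ := by
          apply ENNReal.ofReal_le_ofReal
          rw [integral_affine μ hint]
          have := Real.add_one_le_exp (2 * m / b)
          have e : 2 / b * m = 2 * m / b := by ring
          rw [e]; linarith
  have h2 := lint_exp_sum (n := n) μ (fun _ x => Z x / b) (fun _ => hZ.div_const b)
  have hmeas : Measurable fun x : Fin n → X => ENNReal.ofReal (Real.exp (∑ i, Z (x i) / b)) := by
    have : Measurable fun x : Fin n → X => ∑ i, Z (x i) / b :=
      Finset.measurable_sum _ fun i _ => (hZ.comp (measurable_pi_apply i)).div_const b
    fun_prop
  have hc0 : 0 < Real.exp (n * (2 * m / b) + l) := Real.exp_pos _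
  have sub : {x : Fin n → X | 2 * n * m + b * l ≤ ∑ i, Z (x i)}
      ⊆ {x | ENNReal.ofReal (Real.exp (n * (2 * m / b) + l)) ≤ ENNReal.ofReal (Real.exp (∑ i, Z (x i) / b))} := by
    intro x hx
    apply ENNReal.ofReal_le_ofReal
    apply Real.exp_le_exp.2
    rw [← Finset.sum_div, le_div_iff₀ hb]
    have : (n * (2 * m / b) + l) * b = 2 * n * m + b * l := by field_simp
    rw [this]; exact hx
  refine (measure_mono sub).trans ?_
  refine (meas_ge_le_lintegral_div hmeas.aemeasurable (by simpa using hc0) ENNReal.ofReal_ne_top).trans ?_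
  rw [h2]
  have h3 : ∏ i : Fin n, ∫⁻ e, ENNReal.ofReal (Real.exp (Z e / b)) ∂μ ≤ ENNReal.ofReal (Real.exp (n * (2 * m / b))) := by
    rw [Finset.prod_const, Finset.card_univ, Fintype.card_fin, Real.exp_nat_mul, ENNReal.ofReal_pow (Real.exp_pos _).le]
    exact pow_le_pow_left' h1 n
  refine (ENNReal.div_le_div_right h3 _).trans ?_
  rw [← ENNReal.ofReal_div_of_pos hc0, ← Real.exp_sub]
  apply ENNReal.ofReal_le_ofReal
  apply Real.exp_le_exp.2
  linarith

open ProbabilityTheory in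
lemma gauss_mgf (t : ℝ) : ∫⁻ g, ENNReal.ofReal (Real.exp (t * g)) ∂(gaussianReal 0 1)
    = ENNReal.ofReal (Real.exp (t ^ 2 / 2)) := by
  rw [← ofReal_integral_eq_lintegral_ofReal (integrable_exp_mul_gaussianReal t)
    (Filter.Eventually.of_forall fun x => (Real.exp_pos _).le)]
  have := congrFun (mgf_id_gaussianReal (μ := 0) (v := 1)) t
  simp only [mgf, id] at this
  rw [this]; simp

open ProbabilityTheory in
lemma gauss_sq : ∫⁻ g, ENNReal.ofReal (Real.exp (g ^ 2 / 4)) ∂(gaussianReal 0 1)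
    ≤ ENNReal.ofReal (Real.exp 1) := by
  rw [gaussianReal_of_var_ne_zero 0 one_ne_zero,
    lintegral_withDensity_eq_lintegral_mul _ (measurable_gaussianPDF 0 1) (by fun_prop)]
  have e : ∀ g : ℝ, (gaussianPDF 0 1 * fun g => ENNReal.ofReal (Real.exp (g ^ 2 / 4))) g
      = ENNReal.ofReal ((√(2 * π))⁻¹ * Real.exp (-(1/4) * g ^ 2)) := by
    intro g
    rw [Pi.mul_apply, gaussianPDF, ← ENNReal.ofReal_mul (gaussianPDFReal_nonneg _ _ _), gaussianPDFReal]
    congr 1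
    rw [mul_assoc, ← Real.exp_add]
    simp only [NNReal.coe_one, mul_one, sub_zero]
    congr 2
    ring
  simp only [e]
  have hi : Integrable (fun g : ℝ => (√(2 * π))⁻¹ * Real.exp (-(1/4) * g ^ 2)) :=
    (integrable_exp_neg_mul_sq (by norm_num)).const_mul _
  rw [← ofReal_integral_eq_lintegral_ofReal hi (Filter.Eventually.of_forall fun x => by positivity),
    integral_const_mul, integral_gaussian]
  apply ENNReal.ofReal_le_ofReal
  have hp := Real.pi_pos
  have : (√(2 * π))⁻¹ * √(π / (1/4)) = √2 := by
    rw [← Real.sqrt_inv, ← Real.sqrt_mul (by positivity)]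
    congr 1; field_simp; norm_num
  rw [this]
  have h1 := Real.exp_one_gt_d9
  have h2 : √2 ≤ 2 := by
    rw [Real.sqrt_le_left (by norm_num)]; norm_num
  linarith

lemma noise_mgf (ν : Measure ℝ) [IsProbabilityMeasure ν] (b : ℝ) (hb : 0 < b)
    (hmean : ∫ e, e ∂ν = 0) (hbdd : ∀ᵐ e ∂ν, |e| ≤ b) (t : ℝ) :
    ∫⁻ e, ENNReal.ofReal (Real.exp (t * e)) ∂ν ≤ ENNReal.ofReal (Real.exp (b ^ 2 * t ^ 2 / 2)) := by
  have h := ProbabilityTheory.hasSubgaussianMGF_of_mem_Icc_of_integral_eq_zero (X := fun e : ℝ => e) (μ := ν)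
    (a := -b) (b := b) measurable_id.aemeasurable (by
      filter_upwards [hbdd] with e he using abs_le.1 he) hmean
  rw [← ofReal_integral_eq_lintegral_ofReal (h.integrable_exp_mul t)
    (Filter.Eventually.of_forall fun x => (Real.exp_pos _).le)]
  apply ENNReal.ofReal_le_ofReal
  have := h.mgf_le t
  simp only [ProbabilityTheory.mgf] at this
  refine this.trans (le_of_eq ?_)
  congr 3
  simp
  rw [abs_of_pos (by linarith)]; ring

open ProbabilityTheory in
lemma noise_chi {n d : ℕ} (ν : Measure ℝ) [IsProbabilityMeasure ν] (b : ℝ) (hb : 0 < b)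
    (hmean : ∫ e, e ∂ν = 0) (hbdd : ∀ᵐ e ∂ν, |e| ≤ b) (A : Matrix (Fin d) (Fin n) ℝ)
    (hA : ∀ g, (Aᵀ *ᵥ g) ⬝ᵥ (Aᵀ *ᵥ g) ≤ g ⬝ᵥ g) :
    ∫⁻ η : Fin n → ℝ, ENNReal.ofReal (Real.exp ((4 * b ^ 2)⁻¹ * ((A *ᵥ η) ⬝ᵥ (A *ᵥ η)))) ∂(Measure.pi fun _ => ν)
      ≤ ENNReal.ofReal (Real.exp d) := by
  set s : ℝ := √(2 * (4 * b ^ 2)⁻¹) with hs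
  have hs2 : s ^ 2 = 2 * (4 * b ^ 2)⁻¹ := Real.sq_sqrt (by positivity)
  have hb2 : b ^ 2 * s ^ 2 / 2 = 1 / 4 := by rw [hs2]; field_simp
  have e1 : ∀ η : Fin n → ℝ, ENNReal.ofReal (Real.exp ((4 * b ^ 2)⁻¹ * ((A *ᵥ η) ⬝ᵥ (A *ᵥ η))))
      = ∫⁻ g : Fin d → ℝ, ENNReal.ofReal (Real.exp (∑ i, (s * (A *ᵥ η) i) * g i)) ∂(Measure.pi fun _ => gaussianReal 0 1) := by
    intro η
    rw [lint_exp_sum (gaussianReal 0 1) (fun i g => (s * (A *ᵥ η) i) * g) (fun i => by fun_prop)]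
    simp only [gauss_mgf]
    rw [← ENNReal.ofReal_prod_of_nonneg (fun i _ => (Real.exp_pos _).le), ← Real.exp_sum]
    congr 2
    rw [dotProduct, Finset.mul_sum]
    refine Finset.sum_congr rfl fun i _ => ?_
    rw [mul_pow, hs2]; ring
  simp only [e1]
  have e2 : ∀ (η : Fin n → ℝ) (g : Fin d → ℝ), ∑ i, (s * (A *ᵥ η) i) * g i = ∑ j, (s * (Aᵀ *ᵥ g) j) * η j := by
    intro η g
    have : (A *ᵥ η) ⬝ᵥ g = (Aᵀ *ᵥ g) ⬝ᵥ η := by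
      rw [dotProduct_comm, Matrix.dotProduct_mulVec, Matrix.mulVec_transpose]
    simp only [dotProduct] at this
    simp only [mul_assoc, ← Finset.mul_sum, this]
  rw [lintegral_lintegral_swap]
  · calc _ ≤ ∫⁻ g : Fin d → ℝ, ENNReal.ofReal (Real.exp (∑ i, g i ^ 2 / 4)) ∂(Measure.pi fun _ => gaussianReal 0 1) := by
          refine lintegral_mono fun g => ?_
          simp only [e2]
          rw [lint_exp_sum ν (fun j e => (s * (Aᵀ *ᵥ g) j) * e) (fun i => by fun_prop)]
          calc _ ≤ ∏ j, ENNReal.ofReal (Real.exp (b ^ 2 * (s * (Aᵀ *ᵥ g) j) ^ 2 / 2)) :=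
                Finset.prod_le_prod' fun j _ => noise_mgf ν b hb hmean hbdd _
            _ = ENNReal.ofReal (Real.exp (∑ j, b ^ 2 * (s * (Aᵀ *ᵥ g) j) ^ 2 / 2)) := by
                rw [← ENNReal.ofReal_prod_of_nonneg (fun i _ => (Real.exp_pos _).le), ← Real.exp_sum]
            _ ≤ _ := by
                apply ENNReal.ofReal_le_ofReal
                apply Real.exp_le_exp.2
                have h := hA g
                simp only [dotProduct] at h
                have e3 : ∀ j, b ^ 2 * (s * (Aᵀ *ᵥ g) j) ^ 2 / 2 = 1 / 4 * ((Aᵀ *ᵥ g) j * (Aᵀ *ᵥ g) j) := by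
                  intro j; rw [← hb2]; ring
                have e4 : ∑ j, b ^ 2 * (s * (Aᵀ *ᵥ g) j) ^ 2 / 2 = 1 / 4 * ∑ j, (Aᵀ *ᵥ g) j * (Aᵀ *ᵥ g) j := by
                  rw [Finset.mul_sum]; exact Finset.sum_congr rfl fun j _ => e3 j
                rw [e4, ← Finset.sum_div]
                simp only [pow_two]
                linarith
      _ = ∏ _i : Fin d, ∫⁻ g, ENNReal.ofReal (Real.exp (g ^ 2 / 4)) ∂(gaussianReal 0 1) :=
          lint_exp_sum (gaussianReal 0 1) (fun _ g => g ^ 2 / 4) (fun i => by fun_prop)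
      _ ≤ _ := by
          rw [Finset.prod_const, Finset.card_univ, Fintype.card_fin]
          refine (pow_le_pow_left' gauss_sq d).trans ?_
          rw [← ENNReal.ofReal_pow (Real.exp_pos _).le, ← Real.exp_nat_mul, mul_one]
  · apply Measurable.aemeasurable
    have : Measurable fun p : (Fin n → ℝ) × (Fin d → ℝ) => ∑ i, (s * (A *ᵥ p.1) i) * p.2 i := by
      refine Finset.measurable_sum _ fun i _ => ?_
      refine (measurable_const.mul ?_).mul ((measurable_pi_apply i).comp measurable_snd)
      exact meas_mulVec (M := fun _ => A) (v := fun p : (Fin n → ℝ) × (Fin d → ℝ) => p.1) (fun _ _ => measurable_const) (fun j => (measurable_pi_apply j).comp measurable_fst) i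
    exact ENNReal.measurable_ofReal.comp (Real.measurable_exp.comp this)

end E2TC

open MeasureTheory Matrix Real
open scoped ENNReal

namespace E2TC

lemma vecMulVec_quad {d : ℕ} (f v : Fin d → ℝ) : v ⬝ᵥ (vecMulVec f f *ᵥ v) = (f ⬝ᵥ v) ^ 2 := by
  rw [Matrix.vecMulVec_mulVec, op_smul_eq_smul, dotProduct_smul, smul_eq_mul, dotProduct_comm v f, pow_two]

/-- empirical covariance -/
noncomputable def emp {n d : ℕ} (f : Fin n → Fin d → ℝ) : Matrix (Fin d) (Fin d) ℝ :=
  (n : ℝ)⁻¹ • ∑ t : Fin n, vecMulVec (f t) (f t)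

lemma emp_mulVec {n d : ℕ} (f : Fin n → Fin d → ℝ) (v : Fin d → ℝ) :
    emp f *ᵥ v = (n : ℝ)⁻¹ • ∑ t, (f t ⬝ᵥ v) • f t := by
  rw [emp, Matrix.smul_mulVec, Matrix.sum_mulVec]
  congr 1
  refine Finset.sum_congr rfl fun t _ => ?_
  rw [Matrix.vecMulVec_mulVec, op_smul_eq_smul]

lemma emp_quad {n d : ℕ} (f : Fin n → Fin d → ℝ) (v : Fin d → ℝ) :
    v ⬝ᵥ (emp f *ᵥ v) = (n : ℝ)⁻¹ * ∑ t, (f t ⬝ᵥ v) ^ 2 := by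
  rw [emp_mulVec, dotProduct_smul, smul_eq_mul, dotProduct_sum]
  congr 1
  refine Finset.sum_congr rfl fun t _ => ?_
  rw [dotProduct_smul, smul_eq_mul, dotProduct_comm v, pow_two]

lemma emp_symm {n d : ℕ} (f : Fin n → Fin d → ℝ) : (emp f)ᵀ = emp f := by
  rw [emp, Matrix.transpose_smul, Matrix.transpose_sum]
  simp [Matrix.transpose_vecMulVec]

lemma reg_quad {d : ℕ} (M : Matrix (Fin d) (Fin d) ℝ) (l : ℝ) (v : Fin d → ℝ) :
    v ⬝ᵥ ((M + l • (1 : Matrix (Fin d) (Fin d) ℝ)) *ᵥ v) = v ⬝ᵥ (M *ᵥ v) + l * (v ⬝ᵥ v) := by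
  rw [Matrix.add_mulVec, Matrix.smul_mulVec, Matrix.one_mulVec, dotProduct_add, dotProduct_smul, smul_eq_mul]

lemma dot_self_nonneg {d : ℕ} (v : Fin d → ℝ) : 0 ≤ v ⬝ᵥ v := by
  simp only [dotProduct]; exact Finset.sum_nonneg fun i _ => mul_self_nonneg _

lemma dot_self_pos {d : ℕ} (v : Fin d → ℝ) (hv : v ≠ 0) : 0 < v ⬝ᵥ v :=
  lt_of_le_of_ne (dot_self_nonneg v) fun h => hv (dotProduct_self_eq_zero.1 h.symm)

lemma cs {d : ℕ} (u v : Fin d → ℝ) : (u ⬝ᵥ v) ^ 2 ≤ (u ⬝ᵥ u) * (v ⬝ᵥ v) := by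
  simp only [dotProduct]
  have := Finset.sum_mul_sq_le_sq_mul_sq Finset.univ u v
  simpa only [pow_two] using this

lemma reg_pd {d : ℕ} {M : Matrix (Fin d) (Fin d) ℝ} (hM : Mᵀ = M) (h0 : ∀ v, 0 ≤ v ⬝ᵥ (M *ᵥ v))
    {l : ℝ} (hl : 0 < l) : (M + l • (1 : Matrix (Fin d) (Fin d) ℝ)).PosDef := by
  refine pd_mk (by simp [hM]) fun v hv => ?_
  rw [reg_quad]
  have := mul_pos hl (dot_self_pos v hv)
  have := h0 v
  linarith

lemma emp_quad_nonneg {n d : ℕ} (f : Fin n → Fin d → ℝ) (v : Fin d → ℝ) : 0 ≤ v ⬝ᵥ (emp f *ᵥ v) := by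
  rw [emp_quad]; positivity

/-- deterministic ridge inequality -/
lemma ridge {n d : ℕ} (f : Fin n → Fin d → ℝ) (l : ℝ) (hl : 0 < l) (w : Fin d → ℝ) (Δ η : Fin n → ℝ)
    (δ : Fin d → ℝ)
    (hδ : δ = (emp f + l • (1 : Matrix (Fin d) (Fin d) ℝ))⁻¹ *ᵥ
      ((n : ℝ)⁻¹ • ∑ t, (w ⬝ᵥ f t + Δ t + η t) • f t) - w) :
    δ ⬝ᵥ ((emp f + l • (1 : Matrix (Fin d) (Fin d) ℝ)) *ᵥ δ) ≤
      2 * (l * (w ⬝ᵥ w) + (n : ℝ)⁻¹ * ∑ t, Δ t ^ 2 +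
        ((n : ℝ)⁻¹ • ∑ t, η t • f t) ⬝ᵥ ((emp f + l • (1 : Matrix (Fin d) (Fin d) ℝ))⁻¹ *ᵥ
          ((n : ℝ)⁻¹ • ∑ t, η t • f t))) := by
  set V := emp f + l • (1 : Matrix (Fin d) (Fin d) ℝ) with hV
  set z : Fin d → ℝ := (n : ℝ)⁻¹ • ∑ t, η t • f t with hz
  have hpd : V.PosDef := reg_pd (emp_symm f) (emp_quad_nonneg f) hl
  have hdet : IsUnit V.det := (Matrix.isUnit_iff_isUnit_det V).1 hpd.isUnit
  have hVi : ∀ u, V *ᵥ (V⁻¹ *ᵥ u) = u := fun u => by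
    rw [Matrix.mulVec_mulVec, Matrix.mul_nonsing_inv _ hdet, Matrix.one_mulVec]
  have e1 : V *ᵥ δ = (n : ℝ)⁻¹ • ∑ t, Δ t • f t + z - l • w := by
    rw [hδ, Matrix.mulVec_sub, hVi, hV, Matrix.add_mulVec, emp_mulVec, Matrix.smul_mulVec, Matrix.one_mulVec, hz,
      ← sub_sub, ← smul_sub, ← smul_add, ← Finset.sum_sub_distrib, ← Finset.sum_add_distrib]
    congr 2
    refine Finset.sum_congr rfl fun t _ => ?_
    rw [← sub_smul, ← add_smul, dotProduct_comm w]
    congr 1; ring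
  have e2 : δ ⬝ᵥ (V *ᵥ δ) = (n : ℝ)⁻¹ * ∑ t, Δ t * (f t ⬝ᵥ δ) + δ ⬝ᵥ z - l * (δ ⬝ᵥ w) := by
    conv_lhs => rw [e1]
    rw [dotProduct_sub, dotProduct_add, dotProduct_smul, dotProduct_smul, dotProduct_sum]
    simp only [dotProduct_smul, smul_eq_mul, dotProduct_comm δ (f _)]
  have e3 : δ ⬝ᵥ (V *ᵥ δ) = (n : ℝ)⁻¹ * ∑ t, (f t ⬝ᵥ δ) ^ 2 + l * (δ ⬝ᵥ δ) := by
    rw [hV, reg_quad, emp_quad]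
  have b1 : (n : ℝ)⁻¹ * ∑ t, Δ t * (f t ⬝ᵥ δ) ≤ (n : ℝ)⁻¹ * ∑ t, Δ t ^ 2 + ((n : ℝ)⁻¹ * ∑ t, (f t ⬝ᵥ δ) ^ 2) / 4 := by
    have : ∑ t, Δ t * (f t ⬝ᵥ δ) ≤ ∑ t, Δ t ^ 2 + (∑ t, (f t ⬝ᵥ δ) ^ 2) / 4 := by
      rw [Finset.sum_div, ← Finset.sum_add_distrib]
      exact Finset.sum_le_sum fun t _ => by nlinarith [sq_nonneg (Δ t - (f t ⬝ᵥ δ) / 2)]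
    have := mul_le_mul_of_nonneg_left this (by positivity : (0:ℝ) ≤ (n:ℝ)⁻¹)
    linarith
  have b2 : - (l * (δ ⬝ᵥ w)) ≤ l * (w ⬝ᵥ w) + l * (δ ⬝ᵥ δ) / 4 := by
    have h := dot_self_nonneg (w + (1/2 : ℝ) • δ)
    simp only [dotProduct_add, add_dotProduct, dotProduct_smul, smul_dotProduct, smul_eq_mul,
      dotProduct_comm w δ] at h
    have := mul_nonneg hl.le h
    linarith
  have b3 : ∀ z : Fin d → ℝ, δ ⬝ᵥ z ≤ z ⬝ᵥ (V⁻¹ *ᵥ z) + (δ ⬝ᵥ (V *ᵥ δ)) / 4 := by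
    intro z
    have h := psd_quad hpd.posSemidef (V⁻¹ *ᵥ z - (1/2 : ℝ) • δ)
    have hs : ∀ x y, x ⬝ᵥ (V *ᵥ y) = y ⬝ᵥ (V *ᵥ x) := by
      intro x y
      rw [Matrix.dotProduct_mulVec, ← Matrix.mulVec_transpose, psd_symm hpd.posSemidef, dotProduct_comm]
    rw [Matrix.mulVec_sub, hVi, Matrix.mulVec_smul] at h
    simp only [dotProduct_sub, sub_dotProduct, dotProduct_smul, smul_dotProduct, smul_eq_mul] at h
    rw [hs (V⁻¹ *ᵥ z) δ, hVi, dotProduct_comm (V⁻¹ *ᵥ z) z] at h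
    linarith
  have b4 := b3 z
  linarith

lemma noise_app {n d : ℕ} (hn : 0 < n) (ν : Measure ℝ) [IsProbabilityMeasure ν] (b : ℝ) (hb : 0 < b)
    (hmean : ∫ e, e ∂ν = 0) (hbdd : ∀ᵐ e ∂ν, |e| ≤ b) (f : Fin n → Fin d → ℝ) (l : ℝ) (hl : 0 < l) :
    ∫⁻ η : Fin n → ℝ, ENNReal.ofReal (Real.exp ((4 * b ^ 2)⁻¹ * (n * 
        (((n : ℝ)⁻¹ • ∑ t, η t • f t) ⬝ᵥ ((emp f + l • (1 : Matrix (Fin d) (Fin d) ℝ))⁻¹ *ᵥ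
          ((n : ℝ)⁻¹ • ∑ t, η t • f t)))))) ∂(Measure.pi fun _ => ν)
      ≤ ENNReal.ofReal (Real.exp d) := by
  set V := emp f + l • (1 : Matrix (Fin d) (Fin d) ℝ) with hV
  have hpd : V.PosDef := reg_pd (emp_symm f) (emp_quad_nonneg f) hl
  have hn' : (0:ℝ) < n := by exact_mod_cast hn
  obtain ⟨B, hB, hB1⟩ := factor_inv hpd
  let F : Matrix (Fin d) (Fin n) ℝ := Matrix.of fun i t => f t i
  let r : ℝ := (√n)⁻¹
  have hr : r * r = (n:ℝ)⁻¹ := by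
    show (√n)⁻¹ * (√n)⁻¹ = _
    rw [← mul_inv, Real.mul_self_sqrt hn'.le]
  let A : Matrix (Fin d) (Fin n) ℝ := r • (Bᵀ * F)
  have hF : ∀ η : Fin n → ℝ, F *ᵥ η = ∑ t, η t • f t := by
    intro η; funext i
    simp [F, Matrix.mulVec, dotProduct, Finset.sum_apply, mul_comm]
  have hFt : ∀ u : Fin d → ℝ, Fᵀ *ᵥ u = fun t => f t ⬝ᵥ u := by
    intro u; funext t; rfl
  have h := noise_chi ν b hb hmean hbdd A (by
    intro g
    have e1 : Aᵀ *ᵥ g = r • (fun t => f t ⬝ᵥ (B *ᵥ g)) := by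
      simp only [A, Matrix.transpose_smul, Matrix.transpose_mul, Matrix.transpose_transpose, Matrix.smul_mulVec]
      rw [← Matrix.mulVec_mulVec, hFt]
    have e2 : g ⬝ᵥ g = (B *ᵥ g) ⬝ᵥ (V *ᵥ (B *ᵥ g)) := by
      rw [← quad_conj, hB1, Matrix.one_mulVec]
    rw [e1, e2, hV, reg_quad, emp_quad, smul_dotProduct, dotProduct_smul, smul_eq_mul, smul_eq_mul, ← mul_assoc, hr]
    have := mul_nonneg hl.le (dot_self_nonneg (B *ᵥ g))
    have e3 : ((fun t => f t ⬝ᵥ (B *ᵥ g)) ⬝ᵥ fun t => f t ⬝ᵥ (B *ᵥ g)) = ∑ t, (f t ⬝ᵥ (B *ᵥ g)) ^ 2 := by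
      simp only [dotProduct, pow_two]
    rw [e3]; linarith)
  refine le_trans (le_of_eq ?_) h
  refine lintegral_congr fun η => ?_
  congr 3
  have e1 : A *ᵥ η = r • (Bᵀ *ᵥ ∑ t, η t • f t) := by
    simp only [A, Matrix.smul_mulVec]
    rw [← Matrix.mulVec_mulVec, hF]
  set s := ∑ t, η t • f t
  rw [e1, hB, smul_dotProduct, dotProduct_smul, smul_dotProduct, Matrix.mulVec_smul, dotProduct_smul,
    ← Matrix.mulVec_mulVec, Matrix.dotProduct_mulVec s B, ← Matrix.mulVec_transpose]
  simp only [smul_eq_mul]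
  rw [← mul_assoc r r, hr]
  field_simp

section cov
variable {X : Type*} [MeasurableSpace X] (DX : Measure X) [IsProbabilityMeasure DX] {d : ℕ}

lemma integral_sandwich (M : X → Matrix (Fin d) (Fin d) ℝ) (G P Q : Matrix (Fin d) (Fin d) ℝ)
    (hint : ∀ i j, Integrable (fun x => M x i j) DX) (hG : ∀ i j, ∫ x, M x i j ∂DX = G i j) (i j : Fin d) :
    Integrable (fun x => (P * M x * Q) i j) DX ∧ ∫ x, (P * M x * Q) i j ∂DX = (P * G * Q) i j := by
  have hI : ∀ k l, Integrable (fun x => P i l * M x l k * Q k j) DX := fun k l => ((hint l k).const_mul _).mul_const _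
  simp only [Matrix.mul_apply, Finset.sum_mul]
  constructor
  · exact integrable_finsetSum _ fun k _ => integrable_finsetSum _ fun l _ => hI k l
  · rw [integral_finsetSum _ fun k _ => integrable_finsetSum _ fun l _ => hI k l]
    refine Finset.sum_congr rfl fun k _ => ?_
    rw [integral_finsetSum _ fun l _ => hI k l]
    refine Finset.sum_congr rfl fun l _ => ?_
    rw [integral_mul_const, integral_const_mul, hG]

lemma feat_int (f : X → Fin d → ℝ) (hf : ∀ i, Measurable fun x => f x i) (B : ℝ) (hB : ∀ x, f x ⬝ᵥ f x ≤ B ^ 2)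
    (i j : Fin d) : Integrable (fun x => f x i * f x j) DX := by
  refine Integrable.of_bound ((hf i).mul (hf j)).aestronglyMeasurable (B ^ 2) (Filter.Eventually.of_forall fun x => ?_)
  have h : ∀ i, f x i ^ 2 ≤ B ^ 2 := fun i => by
    refine le_trans ?_ (hB x)
    simp only [dotProduct, ← pow_two]
    exact Finset.single_le_sum (f := fun i => f x i ^ 2) (fun i _ => sq_nonneg _) (Finset.mem_univ i)
  rw [Real.norm_eq_abs, abs_le]
  have := h i; have := h j
  constructor <;> nlinarith [sq_nonneg (f x i - f x j), sq_nonneg (f x i + f x j)]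

lemma Sig_quad (f : X → Fin d → ℝ) (hf : ∀ i, Measurable fun x => f x i) (B : ℝ) (hB : ∀ x, f x ⬝ᵥ f x ≤ B ^ 2)
    (v : Fin d → ℝ) :
    v ⬝ᵥ ((Matrix.of fun i j => ∫ x, f x i * f x j ∂DX) *ᵥ v) = ∫ x, (f x ⬝ᵥ v) ^ 2 ∂DX := by
  have e : ∀ x, (f x ⬝ᵥ v) ^ 2 = ∑ i, ∑ j, v i * ((f x i * f x j) * v j) := by
    intro x
    rw [pow_two]; simp only [dotProduct]
    rw [Finset.sum_mul_sum]
    exact Finset.sum_congr rfl fun i _ => Finset.sum_congr rfl fun j _ => by ring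
  have hI : ∀ i j, Integrable (fun x => v i * ((f x i * f x j) * v j)) DX :=
    fun i j => ((feat_int DX f hf B hB i j).mul_const _).const_mul _
  simp only [e]
  rw [integral_finsetSum _ fun k _ => integrable_finsetSum _ fun l _ => hI k l]
  simp only [dotProduct, Matrix.mulVec, Finset.mul_sum, Matrix.of_apply]
  refine Finset.sum_congr rfl fun k _ => ?_
  rw [integral_finsetSum _ fun l _ => hI k l]
  refine Finset.sum_congr rfl fun l _ => ?_
  rw [integral_const_mul, integral_mul_const]

lemma cov_tail (f : X → Fin d → ℝ) (hf : ∀ i, Measurable fun x => f x i) (B : ℝ) (hB0 : 0 < B)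
    (hB : ∀ x, f x ⬝ᵥ f x ≤ B ^ 2) (n : ℕ) (h1 : 1 ≤ Real.log n) (hn : 320 * Real.log n ≤ n)
    (hd : (d : ℝ) ≤ (n : ℝ) ^ 2) :
    (Measure.pi fun _ : Fin n => DX) {x | ¬ ∀ v,
      v ⬝ᵥ ((Matrix.of fun i j => ∫ x, f x i * f x j ∂DX) *ᵥ v) ≤
        736 * (v ⬝ᵥ ((emp (fun t => f (x t)) + (7 * B ^ 2 * Real.log n / n) • (1 : Matrix (Fin d) (Fin d) ℝ)) *ᵥ v))}
      ≤ ENNReal.ofReal (2 / n) := by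
  set S : Matrix (Fin d) (Fin d) ℝ := Matrix.of fun i j => ∫ x, f x i * f x j ∂DX with hS
  set L := Real.log n with hL
  have hn0 : (0:ℝ) < n := by linarith
  have hn0' : 0 < n := by exact_mod_cast hn0
  set l : ℝ := 320 * B ^ 2 * L / n with hl
  have hlpos : 0 < l := by positivity
  have hSq : ∀ v, 0 ≤ v ⬝ᵥ (S *ᵥ v) := fun v => by
    rw [hS, Sig_quad DX f hf B hB]; exact integral_nonneg fun x => sq_nonneg _
  have hSs : Sᵀ = S := by
    ext i j; simp [hS, mul_comm]
  set G := S + l • (1 : Matrix (Fin d) (Fin d) ℝ) with hG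
  have hGpd : G.PosDef := reg_pd hSs hSq hlpos
  have hGdet : IsUnit G.det := (Matrix.isUnit_iff_isUnit_det G).1 hGpd.isUnit
  obtain ⟨Cm, hC, hC1⟩ := factor_inv hGpd
  let M : X → Matrix (Fin d) (Fin d) ℝ := fun x => vecMulVec (f x) (f x) + l • (1 : Matrix (Fin d) (Fin d) ℝ)
  let H : X → Matrix (Fin d) (Fin d) ℝ := fun x => Cmᵀ * M x * Cm
  have hMq : ∀ x v, v ⬝ᵥ (M x *ᵥ v) = (f x ⬝ᵥ v) ^ 2 + l * (v ⬝ᵥ v) := fun x v => by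
    simp only [M]; rw [reg_quad, vecMulVec_quad]
  have hHq : ∀ x v, v ⬝ᵥ (H x *ᵥ v) = (f x ⬝ᵥ (Cm *ᵥ v)) ^ 2 + l * ((Cm *ᵥ v) ⬝ᵥ (Cm *ᵥ v)) := fun x v => by
    simp only [H]; rw [quad_conj, hMq]
  have hMm : ∀ i j, Measurable fun x => M x i j := fun i j => by
    simp only [M, Matrix.add_apply, Matrix.vecMulVec_apply]
    exact ((hf i).mul (hf j)).add measurable_const
  have hMi : ∀ i j, Integrable (fun x => M x i j) DX := fun i j => by
    simp only [M, Matrix.add_apply, Matrix.vecMulVec_apply]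
    exact (feat_int DX f hf B hB i j).add (integrable_const _)
  have hMG : ∀ i j, ∫ x, M x i j ∂DX = G i j := fun i j => by
    simp only [M, Matrix.add_apply, Matrix.vecMulVec_apply]
    rw [integral_add (feat_int DX f hf B hB i j) (integrable_const _)]
    simp [hG, hS]
  have hCq : ∀ v, v ⬝ᵥ v = (Cm *ᵥ v) ⬝ᵥ (G *ᵥ (Cm *ᵥ v)) := fun v => by
    rw [← quad_conj, hC1, Matrix.one_mulVec]
  obtain ⟨m, hm1, hm2⟩ := exists_nat_pow_near (x := 5 * L) (y := 2) (by linarith) (by norm_num)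
  set D : ℝ := B ^ 2 / l + 1 with hD
  have hDv : B ^ 2 / l = n / (320 * L) := by rw [hl]; field_simp
  have h320 : 1 ≤ n / (320 * L) := by rw [le_div_iff₀ (by positivity)]; linarith
  have hqk : (((2 ^ (m + 1) : ℕ) : ℝ)) ≤ 10 * L := by push_cast; rw [pow_succ]; linarith
  have key := lower_tail DX H (m + 1) D
    (fun i j => meas_mul (meas_mul (M := fun _ => Cmᵀ) (fun _ _ => measurable_const) hMm) (N := fun _ => Cm)
      (fun _ _ => measurable_const) i j)
    (fun i j => (integral_sandwich DX M G Cmᵀ Cm hMi hMG i j).1)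
    (fun i j => by rw [(integral_sandwich DX M G Cmᵀ Cm hMi hMG i j).2, hC1])
    (fun x => by
      refine psd_mk ?_ fun v => ?_
      · simp only [H, M, Matrix.transpose_mul, Matrix.transpose_transpose, Matrix.transpose_add,
          Matrix.transpose_smul, Matrix.transpose_one, Matrix.transpose_vecMulVec, Matrix.mul_assoc]
      · rw [hHq]
        have := mul_nonneg hlpos.le (dot_self_nonneg (Cm *ᵥ v))
        positivity)
    (fun x v => by
      rw [hHq]
      have a1 : l * ((Cm *ᵥ v) ⬝ᵥ (Cm *ᵥ v)) ≤ v ⬝ᵥ v := by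
        rw [hCq v, hG, reg_quad]
        have := hSq (Cm *ᵥ v); linarith
      have a2 : (f x ⬝ᵥ (Cm *ᵥ v)) ^ 2 ≤ B ^ 2 * ((Cm *ᵥ v) ⬝ᵥ (Cm *ᵥ v)) :=
        (cs _ _).trans (mul_le_mul_of_nonneg_right (hB x) (dot_self_nonneg _))
      have a3 : B ^ 2 * ((Cm *ᵥ v) ⬝ᵥ (Cm *ᵥ v)) ≤ B ^ 2 / l * (v ⬝ᵥ v) := by
        have := mul_le_mul_of_nonneg_left a1 (by positivity : 0 ≤ B ^ 2 / l)
        have e : B ^ 2 / l * (l * ((Cm *ᵥ v) ⬝ᵥ (Cm *ᵥ v))) = B ^ 2 * ((Cm *ᵥ v) ⬝ᵥ (Cm *ᵥ v)) := by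
          field_simp
        linarith
      rw [hD, add_mul]; linarith)
    n hn0' (by rw [hD, hDv]; linarith) (by
      have hDle : D ≤ 2 * (n / (320 * L)) := by rw [hD, hDv]; linarith
      calc _ ≤ (10 * L) * (2 * (n / (320 * L))) := by
            apply mul_le_mul hqk hDle (by rw [hD]; positivity) (by positivity)
        _ = n / 16 := by field_simp; norm_num)
  refine le_trans (measure_mono ?_) (key.trans (ENNReal.ofReal_le_ofReal ?_))
  · intro x hx hall
    apply hx
    intro u
    set v := Cmᵀ *ᵥ (G *ᵥ u) with hv
    have hCv : Cm *ᵥ v = u := by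
      rw [hv, Matrix.mulVec_mulVec, ← hC, Matrix.mulVec_mulVec, Matrix.nonsing_inv_mul _ hGdet, Matrix.one_mulVec]
    have h := hall v
    rw [hCq v, hCv, Matrix.sum_mulVec, dotProduct_sum] at h
    simp only [hHq, hCv] at h
    rw [Finset.sum_add_distrib, Finset.sum_const, Finset.card_univ, Fintype.card_fin, nsmul_eq_mul, hG, reg_quad] at h
    rw [reg_quad, emp_quad]
    have hu := dot_self_nonneg u
    set q := ∑ t, (f (x t) ⬝ᵥ u) ^ 2
    set p := u ⬝ᵥ u
    set s := u ⬝ᵥ (S *ᵥ u)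
    have h2 : s + l * p ≤ 16 * ((n:ℝ)⁻¹ * q + l * p) := by
      have e : s + l * p = 16 * ((n:ℝ)⁻¹ * (n / 16 * (s + l * p))) := by field_simp
      have e' : (n:ℝ)⁻¹ * q + l * p = (n:ℝ)⁻¹ * (q + n * (l * p)) := by field_simp
      rw [e, e']
      have := mul_le_mul_of_nonneg_left h (by positivity : (0:ℝ) ≤ (n:ℝ)⁻¹)
      linarith
    have e3 : l * p = 320 * (B ^ 2 * L / n * p) := by rw [hl]; ring
    have e4 : 7 * B ^ 2 * L / n * p = 7 * (B ^ 2 * L / n * p) := by ring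
    have e5 : 0 ≤ B ^ 2 * L / n * p := by positivity
    have e6 : 0 ≤ (n:ℝ)⁻¹ * q := by
      have : 0 ≤ q := Finset.sum_nonneg fun i _ => sq_nonneg _
      positivity
    rw [e4]; rw [e3] at h2; linarith
  · have a1 : (2⁻¹ : ℝ) ^ (2 ^ (m + 1)) ≤ Real.exp (-(3 * L)) := by
      have e : (2⁻¹ : ℝ) = Real.exp (-Real.log 2) := by rw [Real.exp_neg, Real.exp_log (by norm_num)]
      rw [e, ← Real.exp_nat_mul]
      apply Real.exp_le_exp.2
      push_cast
      have := Real.log_two_gt_d9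
      have h5 : 5 * L ≤ 2 ^ (m + 1) := hm2.le
      nlinarith
    have a2 : Real.exp (-(3 * L)) = ((n:ℝ) ^ 3)⁻¹ := by
      rw [Real.exp_neg, mul_comm, Real.exp_mul, hL, Real.exp_log hn0]; norm_cast
    calc 2 * (d:ℝ) * (2⁻¹ : ℝ) ^ (2 ^ (m + 1)) ≤ 2 * (n:ℝ) ^ 2 * ((n:ℝ) ^ 3)⁻¹ := by
          rw [← a2]; gcongr
      _ = 2 / (n:ℝ) := by field_simp

end cov

end E2TC

open MeasureTheory Matrix Real
open scoped ENNReal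

namespace E2TC

/-- the constant of the first part -/
noncomputable def C1 (Bw B Bη : ℝ) : ℝ :=
  1472 * (7 * (Bw ^ 2 * B ^ 2) + 2 + (4 * (Bw ^ 2 * B ^ 2) + 1) + 4 * (Bη + 1) ^ 2)

/-- ridge estimate error as a function of the exploration sample -/
noncomputable def err {X : Type*} {n d : ℕ} (f g : X → Fin d → ℝ) (w : Fin d → ℝ) (l : ℝ)
    (p : (Fin n → X) × (Fin n → ℝ)) : Fin d → ℝ :=
  (emp (fun t => f (p.1 t)) + l • (1 : Matrix (Fin d) (Fin d) ℝ))⁻¹ *ᵥ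
      ((n : ℝ)⁻¹ • ∑ t, (w ⬝ᵥ g (p.1 t) + p.2 t) • f (p.1 t)) - w

lemma meas_emp {Ω : Type*} [MeasurableSpace Ω] {n d : ℕ} {f : Fin n → Ω → Fin d → ℝ}
    (hf : ∀ t i, Measurable fun x => f t x i) (l : ℝ) (i j : Fin d) :
    Measurable fun x => (emp (fun t => f t x) + l • (1 : Matrix (Fin d) (Fin d) ℝ)) i j := by
  simp only [emp, Matrix.add_apply, Matrix.smul_apply, Matrix.sum_apply, Matrix.vecMulVec_apply]
  exact ((Finset.measurable_sum _ fun t _ => (hf t i).mul (hf t j)).const_mul _).add measurable_const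

lemma meas_sum {Ω : Type*} [MeasurableSpace Ω] {n d : ℕ} {f : Fin n → Ω → Fin d → ℝ} {y : Fin n → Ω → ℝ}
    (hf : ∀ t i, Measurable fun x => f t x i) (hy : ∀ t, Measurable (y t)) (i : Fin d) :
    Measurable fun x => ((n : ℝ)⁻¹ • ∑ t, y t x • f t x) i := by
  simp only [Pi.smul_apply, Finset.sum_apply]
  exact (Finset.measurable_sum _ fun t _ => (hy t).mul (hf t i)).const_mul _

section joint
variable {X : Type*} [MeasurableSpace X] {n d : ℕ} (f g : X → Fin d → ℝ)
    (hf : ∀ i, Measurable fun x => f x i) (hg : ∀ i, Measurable fun x => g x i) (w : Fin d → ℝ)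

lemma meas_err (hf : ∀ i, Measurable fun x => f x i) (hg : ∀ i, Measurable fun x => g x i) (l : ℝ) (i : Fin d) :
    Measurable fun p : (Fin n → X) × (Fin n → ℝ) => err f g w l p i := by
  simp only [err, Pi.sub_apply]
  refine Measurable.sub ?_ measurable_const
  have hx : ∀ t, Measurable fun p : (Fin n → X) × (Fin n → ℝ) => p.1 t := fun t =>
    (measurable_pi_apply t).comp measurable_fst
  have hft : ∀ (t : Fin n) i, Measurable fun p : (Fin n → X) × (Fin n → ℝ) => f (p.1 t) i := fun t i =>
    (hf i).comp (hx t)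
  refine meas_mulVec (fun i j => meas_inv (fun i j => meas_emp hft l i j) i j) (fun i => ?_) i
  refine meas_sum (f := fun t (p : (Fin n → X) × (Fin n → ℝ)) => f (p.1 t))
    (y := fun t (p : (Fin n → X) × (Fin n → ℝ)) => w ⬝ᵥ g (p.1 t) + p.2 t) hft (fun t => ?_) i
  refine Measurable.add ?_ ((measurable_pi_apply t).comp measurable_snd)
  exact meas_dot (u := fun _ => w) (fun i => measurable_const) fun i => (hg i).comp (hx t)

variable (DX : Measure X) [IsProbabilityMeasure DX] (ν : Measure ℝ) [IsProbabilityMeasure ν]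

lemma delta_sq {Bw B : ℝ} (hw : w ⬝ᵥ w ≤ Bw ^ 2) (hfB : ∀ x, f x ⬝ᵥ f x ≤ B ^ 2)
    (hgB : ∀ x, g x ⬝ᵥ g x ≤ B ^ 2) (x : X) : (w ⬝ᵥ (g x - f x)) ^ 2 ≤ 4 * (Bw ^ 2 * B ^ 2) := by
  have h1 := cs w (g x - f x)
  have h2 : (g x - f x) ⬝ᵥ (g x - f x) ≤ 4 * B ^ 2 := by
    have h := dot_self_nonneg (g x + f x)
    have := hfB x
    have := hgB x
    simp only [dotProduct_add, add_dotProduct, dotProduct_sub, sub_dotProduct] at h ⊢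
    linarith
  calc _ ≤ _ := h1
    _ ≤ Bw ^ 2 * (4 * B ^ 2) := mul_le_mul hw h2 (dot_self_nonneg _) (sq_nonneg _)
    _ = _ := by ring

lemma Sig_le {B : ℝ} (hf : ∀ i, Measurable fun x => f x i) (hfB : ∀ x, f x ⬝ᵥ f x ≤ B ^ 2) (v : Fin d → ℝ) :
    v ⬝ᵥ ((Matrix.of fun i j => ∫ x, f x i * f x j ∂DX) *ᵥ v) ≤ B ^ 2 * (v ⬝ᵥ v) := by
  rw [Sig_quad DX f hf B hfB]
  have h : ∀ x, (f x ⬝ᵥ v) ^ 2 ≤ B ^ 2 * (v ⬝ᵥ v) := fun x =>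
    (cs _ _).trans (mul_le_mul_of_nonneg_right (hfB x) (dot_self_nonneg _))
  calc _ ≤ ∫ x, B ^ 2 * (v ⬝ᵥ v) ∂DX := integral_mono_of_nonneg (Filter.Eventually.of_forall fun x => sq_nonneg _)
        (integrable_const _) (Filter.Eventually.of_forall h)
    _ = _ := by simp

theorem joint_small {Bw B Bη : ℝ} (hB0 : 0 < B) (hBη : 0 ≤ Bη)
    (hf : ∀ i, Measurable fun x => f x i) (hg : ∀ i, Measurable fun x => g x i)
    (hw : w ⬝ᵥ w ≤ Bw ^ 2) (hfB : ∀ x, f x ⬝ᵥ f x ≤ B ^ 2) (hgB : ∀ x, g x ⬝ᵥ g x ≤ B ^ 2)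
    (hmean : ∫ e, e ∂ν = 0) (hbdd : ∀ᵐ e ∂ν, |e| ≤ Bη)
    (h1 : 1 ≤ Real.log n) (hn : 320 * Real.log n ≤ n) (hd : (d : ℝ) ≤ (n : ℝ) ^ 2) (hd1 : (1:ℝ) ≤ d)
    (e2 : ℝ) (he2 : e2 = ∫ x, (w ⬝ᵥ (g x - f x)) ^ 2 ∂DX) (l : ℝ) (hl : l = 7 * B ^ 2 * Real.log n / n) :
    ((Measure.pi fun _ : Fin n => DX).prod (Measure.pi fun _ : Fin n => ν))
      {p | ¬ (err f g w l p ⬝ᵥ ((Matrix.of fun i j => ∫ x, f x i * f x j ∂DX) *ᵥ err f g w l p) ≤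
        C1 Bw B Bη * (e2 * d + d / n + Real.log n / n))} ≤ ENNReal.ofReal (4 / n) := by
  have hn0 : (0:ℝ) < n := by linarith
  have hn0' : 0 < n := by exact_mod_cast hn0
  set L := Real.log n with hL
  have hlpos : 0 < l := by rw [hl]; positivity
  have hexpL : Real.exp (-L) = 1 / n := by rw [Real.exp_neg, hL, Real.exp_log hn0, one_div]
  set S : Matrix (Fin d) (Fin d) ℝ := Matrix.of fun i j => ∫ x, f x i * f x j ∂DX with hS
  set b := Bη + 1 with hb
  have hbpos : 0 < b := by linarith
  set b3 := 4 * (Bw ^ 2 * B ^ 2) + 1 with hb3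
  have hb3pos : 0 < b3 := by positivity
  let V : (Fin n → X) → Matrix (Fin d) (Fin d) ℝ := fun x =>
    emp (fun t => f (x t)) + l • (1 : Matrix (Fin d) (Fin d) ℝ)
  let z : (Fin n → X) × (Fin n → ℝ) → Fin d → ℝ := fun p => (n : ℝ)⁻¹ • ∑ t, p.2 t • f (p.1 t)
  let chi : (Fin n → X) × (Fin n → ℝ) → ℝ := fun p => z p ⬝ᵥ ((V p.1)⁻¹ *ᵥ z p)
  have hx : ∀ t, Measurable fun p : (Fin n → X) × (Fin n → ℝ) => p.1 t := fun t =>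
    (measurable_pi_apply t).comp measurable_fst
  have hft : ∀ (t : Fin n) i, Measurable fun p : (Fin n → X) × (Fin n → ℝ) => f (p.1 t) i := fun t i =>
    (hf i).comp (hx t)
  have hzm : ∀ i, Measurable fun p => z p i := fun i =>
    meas_sum (f := fun t (p : (Fin n → X) × (Fin n → ℝ)) => f (p.1 t))
      (y := fun t (p : (Fin n → X) × (Fin n → ℝ)) => p.2 t) hft
      (fun t => (measurable_pi_apply t).comp measurable_snd) i
  have hchi : Measurable chi :=
    meas_dot hzm fun i => meas_mulVec (fun i j => meas_inv (fun i j => meas_emp hft l i j) i j) hzm i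
  set P := Measure.pi fun _ : Fin n => DX with hP
  set N := Measure.pi fun _ : Fin n => ν with hN
  let Bad1 : Set ((Fin n → X) × (Fin n → ℝ)) := {x | ¬ ∀ v, v ⬝ᵥ (S *ᵥ v) ≤ 736 * (v ⬝ᵥ (V x *ᵥ v))} ×ˢ Set.univ
  let Bad3 : Set ((Fin n → X) × (Fin n → ℝ)) :=
    {x | 2 * n * e2 + b3 * L ≤ ∑ t, (w ⬝ᵥ (g (x t) - f (x t))) ^ 2} ×ˢ Set.univ
  let Bad2 : Set ((Fin n → X) × (Fin n → ℝ)) :=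
    {p | ENNReal.ofReal (Real.exp (d + L)) ≤ ENNReal.ofReal (Real.exp ((4 * b ^ 2)⁻¹ * (n * chi p)))}
  have m1 : (P.prod N) Bad1 ≤ ENNReal.ofReal (2 / n) := by
    rw [Measure.prod_prod, measure_univ, mul_one]
    have := cov_tail DX f hf B hB0 hfB n h1 hn hd
    rw [← hL, ← hl] at this
    exact this
  have m3 : (P.prod N) Bad3 ≤ ENNReal.ofReal (1 / n) := by
    rw [Measure.prod_prod, measure_univ, mul_one, ← hexpL, he2]
    refine scalar_tail DX (fun x => (w ⬝ᵥ (g x - f x)) ^ 2) ?_ b3 hb3pos (fun x => sq_nonneg _) (fun x => ?_) L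
    · refine (meas_dot (u := fun _ => w) (v := fun x => g x - f x) (fun i => measurable_const) fun i => ?_).pow_const 2
      exact (hg i).sub (hf i)
    · have := delta_sq f g w hw hfB hgB x
      linarith
  have m2 : (P.prod N) Bad2 ≤ ENNReal.ofReal (1 / n) := by
    have hmeas : Measurable fun p => ENNReal.ofReal (Real.exp ((4 * b ^ 2)⁻¹ * (n * chi p))) :=
      ENNReal.measurable_ofReal.comp (Real.measurable_exp.comp ((hchi.const_mul _).const_mul _))
    refine (meas_ge_le_lintegral_div hmeas.aemeasurable (by simpa using Real.exp_pos _) ENNReal.ofReal_ne_top).trans ?_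
    rw [lintegral_prod _ hmeas.aemeasurable]
    have h3 : ∫⁻ x, ∫⁻ η, ENNReal.ofReal (Real.exp ((4 * b ^ 2)⁻¹ * (n * chi (x, η)))) ∂N ∂P
        ≤ ENNReal.ofReal (Real.exp d) := by
      calc _ ≤ ∫⁻ _x, ENNReal.ofReal (Real.exp d) ∂P := lintegral_mono fun x =>
            noise_app hn0' ν b hbpos hmean (hbdd.mono fun e he => he.trans (by linarith)) (fun t => f (x t)) l hlpos
        _ = _ := by rw [lintegral_const, measure_univ, mul_one]
    refine (ENNReal.div_le_div_right h3 _).trans ?_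
    rw [← ENNReal.ofReal_div_of_pos (Real.exp_pos _), ← Real.exp_sub, ← hexpL]
    apply ENNReal.ofReal_le_ofReal
    apply Real.exp_le_exp.2
    linarith
  have sub : {p : (Fin n → X) × (Fin n → ℝ) | ¬ (err f g w l p ⬝ᵥ (S *ᵥ err f g w l p) ≤
        C1 Bw B Bη * (e2 * d + d / n + L / n))} ⊆ Bad1 ∪ Bad2 ∪ Bad3 := by
    intro p hp
    by_contra hnot
    apply hp
    simp only [Set.mem_union, not_or] at hnot
    obtain ⟨⟨g1, g2⟩, g3⟩ := hnot
    have g1' : ∀ v, v ⬝ᵥ (S *ᵥ v) ≤ 736 * (v ⬝ᵥ (V p.1 *ᵥ v)) := by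
      by_contra hc; exact g1 ⟨hc, trivial⟩
    have g3' : ∑ t, (w ⬝ᵥ (g (p.1 t) - f (p.1 t))) ^ 2 ≤ 2 * n * e2 + b3 * L := by
      by_contra hc; exact g3 ⟨(not_le.1 hc).le, trivial⟩
    have g2' : chi p ≤ 4 * b ^ 2 * ((d + L) / n) := by
      by_contra hc
      apply g2
      apply ENNReal.ofReal_le_ofReal
      apply Real.exp_le_exp.2
      have hc' := (not_le.1 hc).le
      have h4 : 0 < (4 * b ^ 2)⁻¹ * (n:ℝ) := by positivity
      have := mul_le_mul_of_nonneg_left hc' h4.le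
      have e : (4 * b ^ 2)⁻¹ * (n:ℝ) * (4 * b ^ 2 * ((d + L) / n)) = d + L := by field_simp
      rw [e] at this
      linarith
    have hr := ridge (fun t => f (p.1 t)) l hlpos w (fun t => w ⬝ᵥ (g (p.1 t) - f (p.1 t))) p.2 (err f g w l p) (by
      rw [err]; congr 3
      refine Finset.sum_congr rfl fun t _ => ?_
      rw [dotProduct_sub]; congr 1; ring)
    have hr' : err f g w l p ⬝ᵥ (V p.1 *ᵥ err f g w l p) ≤
      2 * (l * (w ⬝ᵥ w) + (n : ℝ)⁻¹ * ∑ t, (w ⬝ᵥ (g (p.1 t) - f (p.1 t))) ^ 2 + chi p) := hr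
    have hk := g1' (err f g w l p)
    have he0 : 0 ≤ e2 := by rw [he2]; exact integral_nonneg fun x => sq_nonneg _
    have i1 : l * (w ⬝ᵥ w) ≤ 7 * (Bw ^ 2 * B ^ 2) * (L / n) := by
      calc _ ≤ l * Bw ^ 2 := mul_le_mul_of_nonneg_left hw hlpos.le
        _ = _ := by rw [hl]; ring
    have i2 : (n : ℝ)⁻¹ * ∑ t, (w ⬝ᵥ (g (p.1 t) - f (p.1 t))) ^ 2 ≤ 2 * (e2 * d) + b3 * (L / n) := by
      have := mul_le_mul_of_nonneg_left g3' (by positivity : (0:ℝ) ≤ (n:ℝ)⁻¹)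
      have e : (n:ℝ)⁻¹ * (2 * n * e2 + b3 * L) = 2 * e2 + b3 * (L / n) := by field_simp
      have : e2 ≤ e2 * d := le_mul_of_one_le_right he0 hd1
      linarith
    have i3 : 4 * b ^ 2 * ((d + L) / n) = 4 * b ^ 2 * (d / n) + 4 * b ^ 2 * (L / n) := by ring
    rw [i3] at g2'
    have q1 : 0 ≤ e2 * d := mul_nonneg he0 (by linarith)
    have q2 : 0 ≤ (d:ℝ) / n := by positivity
    have q3 : 0 ≤ L / n := by positivity
    have r1 : 0 ≤ Bw ^ 2 * B ^ 2 := by positivity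
    have r2 : 0 ≤ 4 * b ^ 2 := by positivity
    have tot : err f g w l p ⬝ᵥ (S *ᵥ err f g w l p) ≤ 1472 * (7 * (Bw ^ 2 * B ^ 2) * (L / n) +
      (2 * (e2 * d) + b3 * (L / n)) + (4 * b ^ 2 * (d / n) + 4 * b ^ 2 * (L / n))) := by linarith
    refine tot.trans ?_
    rw [C1, ← hb, ← hb3]
    set r := Bw ^ 2 * B ^ 2
    set q := 4 * b ^ 2
    set A1 := e2 * d
    set A2 := (d:ℝ) / n
    set A3 := L / n
    have t1 := mul_nonneg r1 q1
    have t2 := mul_nonneg r1 q2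
    have t4 := mul_nonneg r2 q1
    have t5 := mul_nonneg hb3pos.le q1
    have t6 := mul_nonneg hb3pos.le q2
    nlinarith
  refine (measure_mono sub).trans ?_
  refine (measure_union_le _ _).trans ?_
  refine (add_le_add (measure_union_le _ _) le_rfl).trans ?_
  refine (add_le_add (add_le_add m1 m2) m3).trans ?_
  rw [← ENNReal.ofReal_add (by positivity) (by positivity), ← ENNReal.ofReal_add (by positivity) (by positivity)]
  apply ENNReal.ofReal_le_ofReal
  rw [← add_div, ← add_div]; norm_num

theorem joint_big {Bw B Bη : ℝ} (hB0 : 0 < B) (hBη : 0 ≤ Bη)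
    (hf : ∀ i, Measurable fun x => f x i)
    (hw : w ⬝ᵥ w ≤ Bw ^ 2) (hfB : ∀ x, f x ⬝ᵥ f x ≤ B ^ 2) (hgB : ∀ x, g x ⬝ᵥ g x ≤ B ^ 2)
    (hbdd : ∀ᵐ e ∂ν, |e| ≤ Bη)
    (h1 : 1 ≤ Real.log n) (hn : 320 * Real.log n ≤ n) (hd : (n : ℝ) ^ 2 ≤ d)
    (e2 : ℝ) (he2 : 0 ≤ e2) (l : ℝ) (hl : l = 7 * B ^ 2 * Real.log n / n) :
    ((Measure.pi fun _ : Fin n => DX).prod (Measure.pi fun _ : Fin n => ν))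
      {p | ¬ (err f g w l p ⬝ᵥ ((Matrix.of fun i j => ∫ x, f x i * f x j ∂DX) *ᵥ err f g w l p) ≤
        C1 Bw B Bη * (e2 * d + d / n + Real.log n / n))} ≤ ENNReal.ofReal (4 / n) := by
  have hn0 : (0:ℝ) < n := by linarith
  have hn1 : (1:ℝ) ≤ n := by linarith
  set L := Real.log n with hL
  have hlpos : 0 < l := by rw [hl]; positivity
  set S : Matrix (Fin d) (Fin d) ℝ := Matrix.of fun i j => ∫ x, f x i * f x j ∂DX with hS
  set P := Measure.pi fun _ : Fin n => DX with hP
  set N := Measure.pi fun _ : Fin n => ν with hN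
  have hz : N {η | ¬ ∀ t, |η t| ≤ Bη} = 0 := by
    have : ∀ᵐ η ∂N, ∀ t, |η t| ≤ Bη := by
      rw [ae_all_iff]
      intro t
      exact (measurePreserving_eval (fun _ : Fin n => ν) t).quasiMeasurePreserving.ae hbdd
    exact ae_iff.1 this
  have sub : {p : (Fin n → X) × (Fin n → ℝ) | ¬ (err f g w l p ⬝ᵥ (S *ᵥ err f g w l p) ≤
        C1 Bw B Bη * (e2 * d + d / n + L / n))} ⊆ Set.univ ×ˢ {η | ¬ ∀ t, |η t| ≤ Bη} := by
    intro p hp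
    refine ⟨trivial, fun hη => hp ?_⟩
    have hr := ridge (fun t => f (p.1 t)) l hlpos w (fun t => w ⬝ᵥ (g (p.1 t) - f (p.1 t)) + p.2 t) (fun _ => 0)
      (err f g w l p) (by
        rw [err]; congr 3
        refine Finset.sum_congr rfl fun t _ => ?_
        rw [dotProduct_sub]; congr 1; ring)
    simp only [zero_smul, Finset.sum_const_zero, smul_zero, zero_dotProduct, add_zero] at hr
    set δ := err f g w l p
    have hS1 := Sig_le f DX hf hfB δ
    rw [reg_quad] at hr
    have hq := emp_quad_nonneg (fun t => f (p.1 t)) δ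
    have hterm : ∀ t, (w ⬝ᵥ (g (p.1 t) - f (p.1 t)) + p.2 t) ^ 2 ≤ 8 * (Bw ^ 2 * B ^ 2) + 2 * Bη ^ 2 := by
      intro t
      have a1 := delta_sq f g w hw hfB hgB (p.1 t)
      have a2 : p.2 t ^ 2 ≤ Bη ^ 2 := sq_le_sq' (by linarith [(abs_le.1 (hη t)).1]) (abs_le.1 (hη t)).2
      nlinarith [sq_nonneg (w ⬝ᵥ (g (p.1 t) - f (p.1 t)) - p.2 t)]
    have hsum : (n:ℝ)⁻¹ * ∑ t, (w ⬝ᵥ (g (p.1 t) - f (p.1 t)) + p.2 t) ^ 2 ≤ 8 * (Bw ^ 2 * B ^ 2) + 2 * Bη ^ 2 := by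
      have : ∑ t, (w ⬝ᵥ (g (p.1 t) - f (p.1 t)) + p.2 t) ^ 2 ≤ n * (8 * (Bw ^ 2 * B ^ 2) + 2 * Bη ^ 2) := by
        calc _ ≤ ∑ t : Fin n, (8 * (Bw ^ 2 * B ^ 2) + 2 * Bη ^ 2) := Finset.sum_le_sum fun t _ => hterm t
          _ = _ := by simp; ring
      rw [inv_mul_le_iff₀ hn0]; exact this
    have hld : l * (δ ⬝ᵥ δ) ≤ 2 * (l * Bw ^ 2 + (8 * (Bw ^ 2 * B ^ 2) + 2 * Bη ^ 2)) := by
      have := mul_le_mul_of_nonneg_left hw hlpos.le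
      linarith
    have hBl : B ^ 2 * (δ ⬝ᵥ δ) = n / (7 * L) * (l * (δ ⬝ᵥ δ)) := by rw [hl]; field_simp
    have hnL : n / (7 * L) ≤ (n:ℝ) := by
      rw [div_le_iff₀ (by positivity)]; nlinarith
    have e1 : n / (7 * L) * (l * Bw ^ 2) = Bw ^ 2 * B ^ 2 := by rw [hl]; field_simp
    have hdn : (n:ℝ) ≤ d / n := by rw [le_div_iff₀ hn0, ← pow_two]; exact hd
    have r1 : 0 ≤ Bw ^ 2 * B ^ 2 := by positivity
    set r := Bw ^ 2 * B ^ 2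
    have st : B ^ 2 * (δ ⬝ᵥ δ) ≤ 2 * (r + n * (8 * r + 2 * Bη ^ 2)) := by
      rw [hBl]
      have := mul_le_mul_of_nonneg_left hld (by positivity : (0:ℝ) ≤ n / (7 * L))
      have h9 := mul_le_mul_of_nonneg_right hnL (by positivity : 0 ≤ 8 * r + 2 * Bη ^ 2)
      calc _ ≤ _ := this
        _ = 2 * (n / (7 * L) * (l * Bw ^ 2) + n / (7 * L) * (8 * r + 2 * Bη ^ 2)) := by ring
        _ ≤ _ := by rw [e1]; linarith
    have st2 : 2 * (r + n * (8 * r + 2 * Bη ^ 2)) ≤ (18 * r + 4 * Bη ^ 2) * (d / n) := by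
      have : 2 * (r + n * (8 * r + 2 * Bη ^ 2)) ≤ (18 * r + 4 * Bη ^ 2) * n := by nlinarith
      exact this.trans (mul_le_mul_of_nonneg_left hdn (by positivity))
    have hC : 18 * r + 4 * Bη ^ 2 ≤ C1 Bw B Bη := by
      rw [C1]; nlinarith
    calc _ ≤ _ := hS1
      _ ≤ _ := st
      _ ≤ _ := st2
      _ ≤ C1 Bw B Bη * (d / n) := mul_le_mul_of_nonneg_right hC (by positivity)
      _ ≤ _ := by
        refine mul_le_mul_of_nonneg_left ?_ (le_trans (by positivity) hC)
        have : 0 ≤ e2 * d := by positivity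
        have : 0 ≤ L / n := by positivity
        linarith
  refine (measure_mono sub).trans ?_
  rw [Measure.prod_prod, hz]; simp

end joint

end E2TC

open MeasureTheory Matrix Real
open scoped ENNReal

namespace E2TC

lemma mix_mp {α γ δ : Type*} [MeasurableSpace α] [MeasurableSpace γ] [MeasurableSpace δ] [Countable α]
    [MeasurableSingletonClass α] (μa : Measure α) [IsProbabilityMeasure μa] (μc : Measure γ) [SFinite μc]
    (μd : Measure δ) [SFinite μd] (g : α → γ → δ) (hg : ∀ a, MeasurePreserving (g a) μc μd) :
    MeasurePreserving (fun p : γ × α => g p.2 p.1) (μc.prod μa) μd := by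
  have h1 := MeasurePreserving.skew_product (MeasurePreserving.id μa) (g := g)
    (measurable_from_prod_countable_right fun a => (hg a).measurable)
    (Filter.Eventually.of_forall fun a => (hg a).map_eq)
  exact (measurePreserving_snd.comp h1).comp Measure.measurePreserving_swap

lemma restrict_mp {ι κ E : Type*} [Fintype ι] [Fintype κ] [MeasurableSpace E] (μ : Measure E)
    [IsProbabilityMeasure μ] (e : ι → κ) (he : Function.Injective e) :
    MeasurePreserving (fun (c : κ → E) i => c (e i)) (Measure.pi fun _ => μ) (Measure.pi fun _ => μ) := by
  refine ⟨measurable_pi_lambda _ fun i => measurable_pi_apply _, ?_⟩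
  have h := ProbabilityTheory.iIndepFun_pi (μ := fun _ : κ => μ) (X := fun _ (x : E) => x)
    (fun _ => measurable_id.aemeasurable)
  have h2 := h.precomp he
  rw [ProbabilityTheory.iIndepFun_iff_map_fun_eq_pi_map
    (fun i => (measurable_pi_apply _).aemeasurable)] at h2
  rw [h2]
  congr 1
  funext i
  exact (measurePreserving_eval (fun _ : κ => μ) (e i)).map_eq

section mp
variable {X : Type*} [MeasurableSpace X] {K T n : ℕ} (hnT : n ≤ T)
  (DX : Measure X) [IsProbabilityMeasure DX] (DC : Measure (Fin K → X)) [IsProbabilityMeasure DC]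
  (ν : Measure ℝ) [IsProbabilityMeasure ν] (UA : Measure (Fin K)) [IsProbabilityMeasure UA]

/-- exploration sample -/
def samp (ω : ((Fin T → Fin K → X) × (Fin T → ℝ)) × (Fin n → Fin K)) : (Fin n → X) × (Fin n → ℝ) :=
  (fun t => ω.1.1 (Fin.castLE hnT t) (ω.2 t), fun t => ω.1.2 (Fin.castLE hnT t))

lemma samp_mp (hmarg : ∀ a' : Fin K, DC.map (fun c => c a') = DX) :
    MeasurePreserving (samp (X := X) (K := K) hnT)
      (((Measure.pi fun _ : Fin T => DC).prod (Measure.pi fun _ : Fin T => ν)).prod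
            (Measure.pi fun _ : Fin n => UA))
      ((Measure.pi fun _ : Fin n => DX).prod (Measure.pi fun _ : Fin n => ν)) := by
  refine mix_mp (Measure.pi fun _ : Fin n => UA) _ _
    (fun a (q : (Fin T → Fin K → X) × (Fin T → ℝ)) =>
      ((fun t => q.1 (Fin.castLE hnT t) (a t), fun t => q.2 (Fin.castLE hnT t)) : (Fin n → X) × (Fin n → ℝ)))
    fun a => ?_
  have h1 := restrict_mp DC (Fin.castLE hnT) (Fin.castLE_injective hnT)
  have h2 := restrict_mp ν (Fin.castLE hnT) (Fin.castLE_injective hnT)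
  have h3 := measurePreserving_pi (fun _ : Fin n => DC) (fun _ => DX) (f := fun t c => c (a t))
    (fun t => ⟨measurable_pi_apply _, hmarg _⟩)
  exact (h3.comp h1).prod h2

lemma samp_mp2 (hmarg : ∀ a' : Fin K, DC.map (fun c => c a') = DX) (s : Fin T) (hs : n ≤ (s : ℕ)) :
    MeasurePreserving (fun ω : ((Fin T → Fin K → X) × (Fin T → ℝ)) × (Fin n → Fin K) =>
        (ω.1.1 s, samp hnT ω))
      (((Measure.pi fun _ : Fin T => DC).prod (Measure.pi fun _ : Fin T => ν)).prod
            (Measure.pi fun _ : Fin n => UA))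
      (DC.prod ((Measure.pi fun _ : Fin n => DX).prod (Measure.pi fun _ : Fin n => ν))) := by
  refine mix_mp (Measure.pi fun _ : Fin n => UA) _ _
    (fun a (q : (Fin T → Fin K → X) × (Fin T → ℝ)) =>
      (q.1 s, ((fun t => q.1 (Fin.castLE hnT t) (a t), fun t => q.2 (Fin.castLE hnT t)) : (Fin n → X) × (Fin n → ℝ))))
    fun a => ?_
  let e : Fin (n + 1) → Fin T := Fin.cons s (Fin.castLE hnT)
  have he : Function.Injective e := by
    rw [Fin.cons_injective_iff]
    refine ⟨?_, Fin.castLE_injective hnT⟩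
    rintro ⟨t, rfl⟩
    have := t.2
    simp at hs; omega
  have h1 := restrict_mp DC e he
  have h1' := (measurePreserving_piFinSuccAbove (fun _ : Fin (n + 1) => DC) 0).comp h1
  have h2 := restrict_mp ν (Fin.castLE hnT) (Fin.castLE_injective hnT)
  have h3 := measurePreserving_pi (fun _ : Fin n => DC) (fun _ => DX) (f := fun t c => c (a t))
    (fun t => ⟨measurable_pi_apply _, hmarg _⟩)
  have h4 := ((MeasurePreserving.id DC).prod h3).comp h1'
  exact (measurePreserving_prodAssoc DC (Measure.pi fun _ : Fin n => DX) (Measure.pi fun _ : Fin n => ν)).comp (h4.prod h2)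

lemma expected_abs (hmarg : ∀ a' : Fin K, DC.map (fun c => c a') = DX) (h : X → ℝ) (hh : Measurable h) (c : ℝ)
    (hc : ∀ x, |h x| ≤ c) (s : ℝ) (hs : ∫ x, h x ^ 2 ∂DX ≤ s ^ 2) (hs0 : 0 ≤ s) (a : Fin K) :
    ∫⁻ y, ENNReal.ofReal (2 * |h (y a)|) ∂DC ≤ ENNReal.ofReal (2 * s) := by
  have hm : MeasurePreserving (fun y : Fin K → X => y a) DC DX := ⟨measurable_pi_apply a, hmarg a⟩
  have hmeas : Measurable fun x => ENNReal.ofReal (2 * |h x|) := by fun_prop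
  rw [hm.lintegral_comp hmeas]
  have hi : Integrable (fun x => |h x|) DX :=
    Integrable.of_bound (by fun_prop) c (Filter.Eventually.of_forall fun x => by simpa using hc x)
  have hi2 : Integrable (fun x => h x ^ 2) DX :=
    Integrable.of_bound (by fun_prop) (c ^ 2) (Filter.Eventually.of_forall fun x => by
      rw [Real.norm_of_nonneg (sq_nonneg _), ← sq_abs]
      exact pow_le_pow_left₀ (abs_nonneg _) (hc x) 2)
  rw [← ofReal_integral_eq_lintegral_ofReal (hi.const_mul 2) (Filter.Eventually.of_forall fun x => by positivity),
    integral_const_mul]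
  apply ENNReal.ofReal_le_ofReal
  have hm0 : 0 ≤ ∫ x, |h x| ∂DX := integral_nonneg fun x => abs_nonneg _
  set m := ∫ x, |h x| ∂DX with hmdef
  have hv : 0 ≤ ∫ x, (h x ^ 2 + (-(2 * m) * |h x| + m ^ 2)) ∂DX := integral_nonneg fun x => by
    show 0 ≤ h x ^ 2 + (-(2 * m) * |h x| + m ^ 2)
    rw [← sq_abs (h x)]; nlinarith [sq_nonneg (|h x| - m)]
  have hi3 : Integrable (fun x => -(2 * m) * |h x| + m ^ 2) DX := (hi.const_mul _).add (integrable_const _)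
  rw [integral_add hi2 hi3, integral_add (hi.const_mul _) (integrable_const _), integral_const_mul] at hv
  simp only [integral_const, probReal_univ, one_smul] at hv
  rw [← hmdef] at hv
  have : m ^ 2 ≤ s ^ 2 := by nlinarith
  have := abs_le_of_sq_le_sq this hs0
  linarith [le_abs_self m]

lemma round_bound {d : ℕ} {Ω' : Type*} [MeasurableSpace Ω'] (P : Measure Ω') [IsProbabilityMeasure P]
    (hmarg : ∀ a' : Fin K, DC.map (fun c => c a') = DX)
    (f g : X → Fin d → ℝ) (hf : ∀ i, Measurable fun x => f x i) (hg : ∀ i, Measurable fun x => g x i)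
    (w : Fin d → ℝ) {Bw B : ℝ} (hw : w ⬝ᵥ w ≤ Bw ^ 2) (hfB : ∀ x, f x ⬝ᵥ f x ≤ B ^ 2) (hgB : ∀ x, g x ⬝ᵥ g x ≤ B ^ 2)
    (ε : ℝ) (hε0 : 0 ≤ ε) (hε : ε ^ 2 = ∫ x, (w ⬝ᵥ (g x - f x)) ^ 2 ∂DX)
    (δ : Ω' → Fin d → ℝ) (hδ : ∀ i, Measurable fun p => δ p i) (β M τ : ℝ) (hβ : 0 ≤ β) (hM : 0 ≤ M) (hτ : 0 ≤ τ)
    (bad : Set Ω')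
    (hbad : bad = {p | ¬ (δ p ⬝ᵥ ((Matrix.of fun i j => ∫ x, f x i * f x j ∂DX) *ᵥ δ p) ≤ β)})
    (hP : P bad ≤ ENNReal.ofReal τ) [DecidablePred (· ∈ bad)] :
    Measurable (fun q : (Fin K → X) × Ω' => if q.2 ∈ bad then ENNReal.ofReal M else
      ∑ a, (ENNReal.ofReal (2 * |w ⬝ᵥ (g (q.1 a) - f (q.1 a))|) + ENNReal.ofReal (2 * |f (q.1 a) ⬝ᵥ δ q.2|))) ∧
    ∫⁻ q : (Fin K → X) × Ω', (if q.2 ∈ bad then ENNReal.ofReal M else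
      ∑ a, (ENNReal.ofReal (2 * |w ⬝ᵥ (g (q.1 a) - f (q.1 a))|) + ENNReal.ofReal (2 * |f (q.1 a) ⬝ᵥ δ q.2|))) ∂(DC.prod P)
      ≤ ENNReal.ofReal (K * (2 * ε + 2 * √β) + M * τ) := by
  have hbm : MeasurableSet bad := by
    rw [hbad]
    generalize (Matrix.of fun i j => ∫ x, f x i * f x j ∂DX) = S
    have h1 : ∀ i, Measurable fun p => (S *ᵥ δ p) i := fun i =>
      meas_mulVec (M := fun _ : Ω' => S) (v := δ) (fun _ _ => measurable_const) hδ i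
    have h2 : Measurable fun p => δ p ⬝ᵥ (S *ᵥ δ p) := meas_dot hδ h1
    exact (measurableSet_le h2 measurable_const).compl
  have hya : ∀ a, Measurable fun q : (Fin K → X) × Ω' => q.1 a := fun a => (measurable_pi_apply a).comp measurable_fst
  have hgfm : Measurable fun x => w ⬝ᵥ (g x - f x) :=
    meas_dot (u := fun _ => w) (v := fun x => g x - f x) (fun i => measurable_const) fun i => (hg i).sub (hf i)
  have hm1 : ∀ a, Measurable fun q : (Fin K → X) × Ω' => ENNReal.ofReal (2 * |w ⬝ᵥ (g (q.1 a) - f (q.1 a))|) := by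
    intro a
    have := hgfm.comp (hya a)
    exact ENNReal.measurable_ofReal.comp ((measurable_norm.comp this).const_mul 2)
  have hm2 : ∀ a, Measurable fun q : (Fin K → X) × Ω' => ENNReal.ofReal (2 * |f (q.1 a) ⬝ᵥ δ q.2|) := by
    intro a
    have : Measurable fun q : (Fin K → X) × Ω' => f (q.1 a) ⬝ᵥ δ q.2 :=
      meas_dot (fun i => (hf i).comp (hya a)) fun i => (hδ i).comp measurable_snd
    exact ENNReal.measurable_ofReal.comp ((measurable_norm.comp this).const_mul 2)
  have hmeas : Measurable (fun q : (Fin K → X) × Ω' => if q.2 ∈ bad then ENNReal.ofReal M else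
      ∑ a, (ENNReal.ofReal (2 * |w ⬝ᵥ (g (q.1 a) - f (q.1 a))|) + ENNReal.ofReal (2 * |f (q.1 a) ⬝ᵥ δ q.2|))) :=
    Measurable.ite (measurable_snd hbm) measurable_const
      (Finset.measurable_sum _ fun a _ => (hm1 a).add (hm2 a))
  refine ⟨hmeas, ?_⟩
  rw [lintegral_prod_symm _ hmeas.aemeasurable]
  have inner : ∀ p, ∫⁻ y, (if p ∈ bad then ENNReal.ofReal M else
      ∑ a, (ENNReal.ofReal (2 * |w ⬝ᵥ (g (y a) - f (y a))|) + ENNReal.ofReal (2 * |f (y a) ⬝ᵥ δ p|))) ∂DC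
      ≤ ENNReal.ofReal (K * (2 * ε + 2 * √β)) + bad.indicator (fun _ => ENNReal.ofReal M) p := by
    intro p
    by_cases hp : p ∈ bad
    · simp only [hp, if_true, Set.indicator_of_mem, lintegral_const, measure_univ, mul_one]
      exact le_add_self
    · simp only [hp, if_false, Set.indicator_of_notMem, not_false_eq_true, add_zero]
      have n1 : ∀ a, Measurable fun y : Fin K → X => ENNReal.ofReal (2 * |w ⬝ᵥ (g (y a) - f (y a))|) := fun a => by
        have := hgfm.comp (measurable_pi_apply (X := fun _ : Fin K => X) a)
        exact ENNReal.measurable_ofReal.comp ((measurable_norm.comp this).const_mul 2)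
      have n2 : ∀ a, Measurable fun y : Fin K → X => ENNReal.ofReal (2 * |f (y a) ⬝ᵥ δ p|) := fun a => by
        have : Measurable fun y : Fin K → X => f (y a) ⬝ᵥ δ p :=
          meas_dot (fun i => (hf i).comp (measurable_pi_apply (X := fun _ : Fin K => X) a)) fun i => measurable_const
        exact ENNReal.measurable_ofReal.comp ((measurable_norm.comp this).const_mul 2)
      have n3 : ∀ a, Measurable fun y : Fin K → X => ENNReal.ofReal (2 * |w ⬝ᵥ (g (y a) - f (y a))|) +
          ENNReal.ofReal (2 * |f (y a) ⬝ᵥ δ p|) := fun a => (n1 a).add (n2 a)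
      rw [lintegral_finsetSum _ fun a _ => n3 a]
      have hq : δ p ⬝ᵥ ((Matrix.of fun i j => ∫ x, f x i * f x j ∂DX) *ᵥ δ p) ≤ β := by
        rw [hbad] at hp; simpa using hp
      rw [Sig_quad DX f hf B hfB] at hq
      calc _ ≤ ∑ _a : Fin K, ENNReal.ofReal (2 * ε + 2 * √β) := by
            refine Finset.sum_le_sum fun a _ => ?_
            rw [lintegral_add_left (n1 a), ENNReal.ofReal_add (by positivity) (by positivity)]
            refine add_le_add ?_ ?_
            · refine expected_abs DX DC hmarg (fun x => w ⬝ᵥ (g x - f x)) hgfm (√(4 * (Bw ^ 2 * B ^ 2))) (fun x => ?_) ε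
                hε.ge hε0 a
              exact Real.abs_le_sqrt (delta_sq f g w hw hfB hgB x)
            · refine expected_abs DX DC hmarg (fun x => f x ⬝ᵥ δ p) (meas_dot hf fun _ => measurable_const)
                (√(B ^ 2 * (δ p ⬝ᵥ δ p))) (fun x => ?_) (√β) ?_ (Real.sqrt_nonneg _) a
              · refine Real.abs_le_sqrt ((cs _ _).trans ?_)
                exact mul_le_mul_of_nonneg_right (hfB x) (dot_self_nonneg _)
              · rw [Real.sq_sqrt hβ]; exact hq
        _ = _ := by
            rw [Finset.sum_const, Finset.card_univ, Fintype.card_fin, nsmul_eq_mul,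
              ENNReal.ofReal_mul (by positivity), ENNReal.ofReal_natCast]
  calc _ ≤ ∫⁻ p, (ENNReal.ofReal (K * (2 * ε + 2 * √β)) + bad.indicator (fun _ => ENNReal.ofReal M) p) ∂P :=
        lintegral_mono inner
    _ = ENNReal.ofReal (K * (2 * ε + 2 * √β)) + ENNReal.ofReal M * P bad := by
        rw [lintegral_add_left measurable_const, lintegral_const, measure_univ, mul_one,
          lintegral_indicator_const hbm]
    _ ≤ _ := by
        rw [ENNReal.ofReal_add (by positivity) (by positivity), ENNReal.ofReal_mul hM]
        gcongr

end mp

end E2TC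

open MeasureTheory Matrix Real
open scoped ENNReal

namespace E2TC

lemma C1_pos (Bw B Bη : ℝ) : 0 < C1 Bw B Bη := by
  unfold C1
  have : 0 ≤ Bw ^ 2 * B ^ 2 := by positivity
  have : 0 ≤ (Bη + 1) ^ 2 := by positivity
  linarith

lemma joint_all {X : Type*} [MeasurableSpace X] {n d : ℕ} (f g : X → Fin d → ℝ) (w : Fin d → ℝ)
    (DX : Measure X) [IsProbabilityMeasure DX] (ν : Measure ℝ) [IsProbabilityMeasure ν]
    {Bw B Bη : ℝ} (hB0 : 0 ≤ B) (hBη : 0 ≤ Bη)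
    (hf : ∀ i, Measurable fun x => f x i) (hg : ∀ i, Measurable fun x => g x i)
    (hw : w ⬝ᵥ w ≤ Bw ^ 2) (hfB : ∀ x, f x ⬝ᵥ f x ≤ B ^ 2) (hgB : ∀ x, g x ⬝ᵥ g x ≤ B ^ 2)
    (hmean : ∫ e, e ∂ν = 0) (hbdd : ∀ᵐ e ∂ν, |e| ≤ Bη)
    (h1 : 1 ≤ Real.log n) (hn : 320 * Real.log n ≤ n)
    (e2 : ℝ) (he2 : e2 = ∫ x, (w ⬝ᵥ (g x - f x)) ^ 2 ∂DX)
    (l : ℝ) (hl : l = 7 * B ^ 2 * Real.log n / n) :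
    ((Measure.pi fun _ : Fin n => DX).prod (Measure.pi fun _ : Fin n => ν))
      {p | ¬ (err f g w l p ⬝ᵥ ((Matrix.of fun i j => ∫ x, f x i * f x j ∂DX) *ᵥ err f g w l p) ≤
        C1 Bw B Bη * (e2 * d + d / n + Real.log n / n))} ≤ ENNReal.ofReal (4 / n) := by
  have he0 : 0 ≤ e2 := by rw [he2]; exact integral_nonneg fun x => sq_nonneg _
  by_cases hdeg : ∀ x, f x = 0
  · have : {p : (Fin n → X) × (Fin n → ℝ) | ¬ (err f g w l p ⬝ᵥ ((Matrix.of fun i j => ∫ x, f x i * f x j ∂DX) *ᵥ err f g w l p) ≤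
        C1 Bw B Bη * (e2 * d + d / n + Real.log n / n))} = ∅ := by
      ext p
      simp only [Set.mem_ofPred_eq, Set.mem_empty_iff_false, iff_false, not_not]
      rw [Sig_quad DX f hf B hfB]
      simp only [hdeg, zero_dotProduct]
      have := C1_pos Bw B Bη
      have : 0 ≤ Real.log n := by linarith
      simp
      positivity
    rw [this]; simp
  · push Not at hdeg
    obtain ⟨x, hx⟩ := hdeg
    have hd1 : 1 ≤ d := by
      rcases Nat.eq_zero_or_pos d with rfl | h
      · exact absurd (Subsingleton.elim _ _) hx
      · exact h
    have hB : 0 < B := by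
      rcases hB0.eq_or_lt with rfl | h
      · have := hfB x
        have h2 : f x ⬝ᵥ f x = 0 := le_antisymm (by simpa using this) (dot_self_nonneg _)
        exact absurd (dotProduct_self_eq_zero.1 h2) hx
      · exact h
    rcases le_total d (n^2) with h | h
    · exact joint_small f g w DX ν hB hBη hf hg hw hfB hgB hmean hbdd h1 hn (by exact_mod_cast h) (by exact_mod_cast hd1) e2 he2 l hl
    · exact joint_big f g w DX ν hB hBη hf hw hfB hgB hbdd h1 hn (by exact_mod_cast h) e2 he0 l hl

/-- per round deterministic regret bound -/
lemma regret_M {d : ℕ} (w u v : Fin d → ℝ) {Bw B : ℝ} (hBw : 0 ≤ Bw) (hB : 0 ≤ B) (hw : w ⬝ᵥ w ≤ Bw ^ 2)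
    (hu : u ⬝ᵥ u ≤ B ^ 2) (hv : v ⬝ᵥ v ≤ B ^ 2) : w ⬝ᵥ u - w ⬝ᵥ v ≤ 2 * Bw * B := by
  have key : ∀ z : Fin d → ℝ, z ⬝ᵥ z ≤ B ^ 2 → |w ⬝ᵥ z| ≤ Bw * B := fun z hz => by
    refine abs_le_of_sq_le_sq ?_ (by positivity)
    rw [mul_pow]
    exact (cs w z).trans (mul_le_mul hw hz (dot_self_nonneg _) (sq_nonneg _))
  have h1 := abs_le.1 (key u hu)
  have h2 := abs_le.1 (key v hv)
  linarith

lemma regret_good {X : Type*} {K d : ℕ} (f g : X → Fin d → ℝ) (w w0 : Fin d → ℝ) (y : Fin K → X) (a b : Fin K)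
    (h : w0 ⬝ᵥ f (y a) ≤ w0 ⬝ᵥ f (y b)) :
    w ⬝ᵥ g (y a) - w ⬝ᵥ g (y b) ≤
      ∑ c, (2 * |w ⬝ᵥ (g (y c) - f (y c))| + 2 * |f (y c) ⬝ᵥ (w0 - w)|) := by
  have key : ∀ h : Fin K → ℝ, |h a| + |h b| ≤ ∑ c, 2 * |h c| := fun h => by
    rw [← Finset.mul_sum]
    have h1 := Finset.single_le_sum (f := fun c => |h c|) (fun c _ => abs_nonneg _) (Finset.mem_univ a)
    have h2 := Finset.single_le_sum (f := fun c => |h c|) (fun c _ => abs_nonneg _) (Finset.mem_univ b)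
    linarith
  rw [Finset.sum_add_distrib]
  have k1 := key fun c => w ⬝ᵥ (g (y c) - f (y c))
  have k2 := key fun c => f (y c) ⬝ᵥ (w0 - w)
  refine le_trans ?_ (add_le_add k1 k2)
  have a1 := le_abs_self (w ⬝ᵥ (g (y a) - f (y a)))
  have a2 := neg_abs_le (w ⬝ᵥ (g (y b) - f (y b)))
  have a3 := neg_abs_le (f (y a) ⬝ᵥ (w0 - w))
  have a4 := le_abs_self (f (y b) ⬝ᵥ (w0 - w))
  rw [dotProduct_comm (f (y a))] at a3
  rw [dotProduct_comm (f (y b))] at a4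
  rw [dotProduct_comm (f (y a)), dotProduct_comm (f (y b))]
  simp only [dotProduct_sub, sub_dotProduct] at *
  linarith

lemma exists_N : ∃ N0 : ℕ, 16 ≤ N0 ∧ ∀ n : ℕ, N0 < n → 1 ≤ Real.log n ∧ 320 * Real.log n ≤ n := by
  have h1 : ∀ᶠ x : ℝ in Filter.atTop, 1 ≤ Real.log x := Real.tendsto_log_atTop.eventually_ge_atTop 1
  have h2 : ∀ᶠ x : ℝ in Filter.atTop, ‖Real.log x‖ ≤ (1/320) * ‖x‖ :=
    Real.isLittleO_log_id_atTop.def (by norm_num)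
  have h := tendsto_natCast_atTop_atTop (R := ℝ) |>.eventually (h1.and h2)
  obtain ⟨N, hN⟩ := Filter.eventually_atTop.1 h
  refine ⟨max N 16, le_max_right _ _, fun n hn => ?_⟩
  obtain ⟨a, b⟩ := hN n ((le_max_left _ _).trans hn.le)
  refine ⟨a, ?_⟩
  rw [Real.norm_of_nonneg (by linarith), Real.norm_of_nonneg (by positivity)] at b
  linarith

lemma sqrt_add_le' (a b : ℝ) (ha : 0 ≤ a) (hb : 0 ≤ b) : √(a + b) ≤ √a + √b := by
  rw [Real.sqrt_le_left (by positivity)]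
  have := Real.sq_sqrt ha
  have := Real.sq_sqrt hb
  nlinarith [mul_nonneg (Real.sqrt_nonneg a) (Real.sqrt_nonneg b)]

lemma final_arith {C1 M ε β D n ℓ T K q : ℝ} (hC1 : 0 < C1) (hM : 0 ≤ M) (hε : 0 ≤ ε) (hD : 0 ≤ D) (hn : 1 ≤ n)
    (hℓ : 0 ≤ ℓ) (hT : 0 ≤ T) (hK : 0 ≤ K) (hq : 0 ≤ q) (hεD : ε ≤ ε * √D)
    (hβ : β = C1 * (ε ^ 2 * D + D / n + ℓ / n)) :
    M * n + T * (K * (2 * ε + 2 * √β) + M * (4 / n)) ≤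
      (C1 + 5 * M + 2 + 2 * √C1) * (ε * √D * K * T + T / √n + n + K * T * (√(D / n) + q + √(ℓ / n))) := by
  have hb : √β ≤ √C1 * (ε * √D + √(D / n) + √(ℓ / n)) := by
    rw [hβ, Real.sqrt_mul hC1.le]
    refine mul_le_mul_of_nonneg_left ?_ (Real.sqrt_nonneg _)
    have hsq : √(ε ^ 2 * D) = ε * √D := by rw [Real.sqrt_mul (sq_nonneg _), Real.sqrt_sq hε]
    rw [← hsq]
    refine (sqrt_add_le' _ _ (by positivity) (by positivity)).trans ?_
    gcongr
    exact sqrt_add_le' _ _ (by positivity) (by positivity)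
  have hs : 1 / n ≤ 1 / √n := by
    refine one_div_le_one_div_of_le (by positivity) ?_
    rw [Real.sqrt_le_left (by linarith)]
    nlinarith
  have h4 : T * (M * (4 / n)) ≤ 4 * M * (T / √n) := by
    have := mul_le_mul_of_nonneg_left hs (by positivity : 0 ≤ 4 * M * T)
    calc _ = 4 * M * T * (1 / n) := by ring
      _ ≤ _ := this
      _ = _ := by ring
  set u := ε * √D with hu
  set v := √(D / n)
  set z := √(ℓ / n)
  set s := √C1
  have hu0 : 0 ≤ u := by positivity
  have hv0 : 0 ≤ v := by positivity
  have hz0 : 0 ≤ z := by positivity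
  have hs0 : 0 ≤ s := by positivity
  have hKT : 0 ≤ K * T := by positivity
  have hTn : 0 ≤ T / √n := by positivity
  have h5 : T * (K * (2 * ε + 2 * √β)) ≤ (2 + 2 * s) * (K * T * (u + v + z)) := by
    have : 2 * ε + 2 * √β ≤ (2 + 2 * s) * (u + v + z) := by nlinarith
    calc _ = (K * T) * (2 * ε + 2 * √β) := by ring
      _ ≤ (K * T) * ((2 + 2 * s) * (u + v + z)) := mul_le_mul_of_nonneg_left this hKT
      _ = _ := by ring
  have hA : 0 ≤ K * T * (u + v + z) := by positivity
  have hQ : 0 ≤ K * T * q := by positivity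
  have hall : (C1 + 5 * M + 2 + 2 * s) * (u * K * T + T / √n + n + K * T * (v + q + z)) =
     (C1 + 5 * M + 2 + 2 * s) * (K * T * (u + v + z)) + (C1 + 5 * M + 2 + 2 * s) * (T / √n) + (C1 + 5 * M + 2 + 2 * s) * n + (C1 + 5 * M + 2 + 2 * s) * (K * T * q) := by ring
  rw [hall]
  have e1 : (2 + 2 * s) * (K * T * (u + v + z)) ≤ (C1 + 5 * M + 2 + 2 * s) * (K * T * (u + v + z)) :=
    mul_le_mul_of_nonneg_right (by linarith) hA
  have e2 : 4 * M * (T / √n) ≤ (C1 + 5 * M + 2 + 2 * s) * (T / √n) :=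
    mul_le_mul_of_nonneg_right (by linarith) hTn
  have e3 : M * n ≤ (C1 + 5 * M + 2 + 2 * s) * n :=
    mul_le_mul_of_nonneg_right (by linarith) (by linarith)
  have e4 : 0 ≤ (C1 + 5 * M + 2 + 2 * s) * (K * T * q) := by positivity
  have : T * (K * (2 * ε + 2 * √β) + M * (4 / n)) = T * (K * (2 * ε + 2 * √β)) + T * (M * (4 / n)) := by ring
  linarith

end E2TC

open MeasureTheory Matrix Real
open scoped ENNReal

namespace E2TC

/-- integrate a pointwise bound on the cumulative regret -/
lemma regret_expect {X : Type*} [MeasurableSpace X] {K T n : ℕ} (hnT : n ≤ T)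
    (DX : Measure X) [IsProbabilityMeasure DX] (DC : Measure (Fin K → X)) [IsProbabilityMeasure DC]
    (ν : Measure ℝ) [IsProbabilityMeasure ν] (UA : Measure (Fin K)) [IsProbabilityMeasure UA]
    (hmarg : ∀ a' : Fin K, DC.map (fun c => c a') = DX)
    (F : (Fin K → X) × ((Fin n → X) × (Fin n → ℝ)) → ℝ≥0∞) (hF : Measurable F) (M Q : ℝ) (hM : 0 ≤ M) (hQ : 0 ≤ Q)
    (hFQ : ∫⁻ q, F q ∂(DC.prod ((Measure.pi fun _ : Fin n => DX).prod (Measure.pi fun _ : Fin n => ν))) ≤ ENNReal.ofReal Q)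
    (r : Fin T → ((Fin T → Fin K → X) × (Fin T → ℝ)) × (Fin n → Fin K) → ℝ)
    (hr0 : ∀ t ω, 0 ≤ r t ω) (hrM : ∀ t ω, r t ω ≤ M)
    (hrF : ∀ (t : Fin T) ω, n ≤ (t : ℕ) → ENNReal.ofReal (r t ω) ≤ F (ω.1.1 t, samp hnT ω))
    (R : ((Fin T → Fin K → X) × (Fin T → ℝ)) × (Fin n → Fin K) → ℝ)
    (hR : ∀ ω, R ω = ∑ t, r t ω)
    (hRint : Integrable R (((Measure.pi fun _ : Fin T => DC).prod (Measure.pi fun _ : Fin T => ν)).prod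
            (Measure.pi fun _ : Fin n => UA))) :
    ∫ ω, R ω ∂(((Measure.pi fun _ : Fin T => DC).prod (Measure.pi fun _ : Fin T => ν)).prod
            (Measure.pi fun _ : Fin n => UA)) ≤ M * n + T * Q := by
  set μ := (((Measure.pi fun _ : Fin T => DC).prod (Measure.pi fun _ : Fin T => ν)).prod
            (Measure.pi fun _ : Fin n => UA)) with hμ
  rw [integral_eq_lintegral_of_nonneg_ae
    (Filter.Eventually.of_forall fun ω => by
      show 0 ≤ R ω
      rw [hR]; exact Finset.sum_nonneg fun t _ => hr0 t ω) hRint.aestronglyMeasurable]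
  refine ENNReal.toReal_le_of_le_ofReal (by positivity) ?_
  let G : Fin T → ((Fin T → Fin K → X) × (Fin T → ℝ)) × (Fin n → Fin K) → ℝ≥0∞ := fun t ω =>
    if (t : ℕ) < n then ENNReal.ofReal M else F (ω.1.1 t, samp hnT ω)
  have hGm : ∀ t, Measurable (G t) := fun t => by
    by_cases h : (t : ℕ) < n
    · simp only [G, h, if_true]; exact measurable_const
    · simp only [G, h, if_false]
      exact hF.comp (samp_mp2 hnT DX DC ν UA hmarg t (not_lt.1 h)).measurable
  have hGi : ∀ t, ∫⁻ ω, G t ω ∂μ ≤ (if (t : ℕ) < n then ENNReal.ofReal M else 0) + ENNReal.ofReal Q := fun t => by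
    by_cases h : (t : ℕ) < n
    · simp only [G, h, if_true, lintegral_const, measure_univ, mul_one]; exact le_self_add
    · simp only [G, h, if_false, zero_add]
      have := (samp_mp2 hnT DX DC ν UA hmarg t (not_lt.1 h)).lintegral_comp hF
      rw [hμ, this]; exact hFQ
  calc ∫⁻ ω, ENNReal.ofReal (R ω) ∂μ ≤ ∫⁻ ω, ∑ t, G t ω ∂μ := by
        refine lintegral_mono fun ω => ?_
        show ENNReal.ofReal (R ω) ≤ ∑ t, G t ω
        rw [hR, ENNReal.ofReal_sum_of_nonneg fun t _ => hr0 t ω]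
        refine Finset.sum_le_sum fun t _ => ?_
        by_cases h : (t : ℕ) < n
        · simp only [G, h, if_true]; exact ENNReal.ofReal_le_ofReal (hrM t ω)
        · simp only [G, h, if_false]; exact hrF t ω (not_lt.1 h)
    _ = ∑ t, ∫⁻ ω, G t ω ∂μ := lintegral_finsetSum _ fun t _ => hGm t
    _ ≤ ∑ t : Fin T, ((if (t : ℕ) < n then ENNReal.ofReal M else 0) + ENNReal.ofReal Q) :=
        Finset.sum_le_sum fun t _ => hGi t
    _ ≤ _ := by
        have hc : (Finset.univ.filter fun t : Fin T => (t : ℕ) < n).card ≤ n := by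
          calc _ = ((Finset.univ.filter fun t : Fin T => (t : ℕ) < n).map Fin.valEmbedding).card := by simp
            _ ≤ (Finset.range n).card := Finset.card_le_card fun x hx => by
                simp only [Finset.mem_map, Finset.mem_filter, Finset.mem_univ, true_and] at hx
                obtain ⟨t, ht, rfl⟩ := hx
                simpa using ht
            _ = n := Finset.card_range n
        rw [Finset.sum_add_distrib, ← Finset.sum_filter, Finset.sum_const, Finset.sum_const, Finset.card_univ,
          Fintype.card_fin, nsmul_eq_mul, nsmul_eq_mul, ENNReal.ofReal_add (by positivity) (by positivity),
          mul_comm M, ENNReal.ofReal_mul (by positivity), ENNReal.ofReal_mul (by positivity),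
          ENNReal.ofReal_natCast, ENNReal.ofReal_natCast]
        gcongr

end E2TC


/-- E2TC with `T₂ = 0`, data-rich regime: with regularization
`λ = 7B_φ²(log T₁)/T₁`, for every `a > 0` there exist `N₀(a)` and a constant
`C > 0` depending only on `B_w, B_φ, B_η` such that whenever
`T₁ > max{N₀(a), d^{1/a}}`, (1) with probability greater than `1 − 4/√T₁`,
`‖w₀ − w*‖²_{Σ₀} ≤ C(ε₀²d + d/T₁ + √(d log T₁)/T₁ + (log T₁)/T₁)`, and
(2) the expected pseudo-regret is at most
`C(ε₀√d KT + T/√T₁ + T₁ + KT(√(d/T₁) + d^{1/4}(log T₁)^{1/4}/√T₁ + √((log T₁)/T₁)))`.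

The probability space is
`Ω = ((Fin T → Fin K → X) × (Fin T → ℝ)) × (Fin T1 → Fin K)`, carrying i.i.d.
contexts, i.i.d. bounded zero-mean reward noise, and i.i.d. uniform exploration
actions; during rounds `t ≤ T₁` the played action is the sampled uniform one,
afterwards the action is greedy for the Ridge estimate `w₀` with features
`φ_{θ₀}`. -/
theorem e2tc_weak_training_data_rich
    (Bw Bφ Bη : ℝ) (hBw : 0 ≤ Bw) (hBφ : 0 ≤ Bφ) (hBη : 0 ≤ Bη) :
    ∃ C : ℝ, 0 < C ∧
      ∀ a : ℝ, 0 < a →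
      ∃ N0 : ℕ,
      ∀ (d d0 K T T1 : ℕ) (hK : 0 < K) (hT1T : T1 ≤ T)
        (hT1 : max (N0 : ℝ) ((d : ℝ) ^ ((1 : ℝ) / a)) < (T1 : ℝ))
        (X : Type) (_ : MeasurableSpace X)
        (DX : Measure X) (_ : IsProbabilityMeasure DX)
        (DC : Measure (Fin K → X)) (_ : IsProbabilityMeasure DC)
        (νη : Measure ℝ) (_ : IsProbabilityMeasure νη)
        (UA : Measure (Fin K)) (_ : IsProbabilityMeasure UA)
        (Bθ : ℝ)
        (φ : (Fin d0 → ℝ) → X → Fin d → ℝ)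
        (wstar : Fin d → ℝ) (θstar θ0 : Fin d0 → ℝ)
        (Sig0 : Matrix (Fin d) (Fin d) ℝ)
        (ε0 : ℝ)
        (A : Fin T → ((Fin T → Fin K → X) × (Fin T → ℝ)) × (Fin T1 → Fin K) → Fin K)
        (Astar : Fin T → (Fin T → Fin K → X) → Fin K)
        (w0 : ((Fin T → Fin K → X) × (Fin T → ℝ)) × (Fin T1 → Fin K) → Fin d → ℝ)
        (R : ((Fin T → Fin K → X) × (Fin T → ℝ)) × (Fin T1 → Fin K) → ℝ)
        (hmarg : ∀ a' : Fin K, DC.map (fun c => c a') = DX)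
        (hφmeas : ∀ θ i, Measurable fun x => φ θ x i)
        (hws : vnorm wstar ≤ Bw) (hθs : vnorm θstar ≤ Bθ) (hθ0 : vnorm θ0 ≤ Bθ)
        (hφb : ∀ θ, vnorm θ ≤ Bθ → ∀ x, vnorm (φ θ x) ≤ Bφ)
        (hmean : ∫ e, e ∂νη = 0) (hbdd : ∀ᵐ e ∂νη, |e| ≤ Bη)
        (hUA : ∀ a' : Fin K, UA {a'} = (K : ℝ≥0∞)⁻¹)
        (hSig0 : Sig0 = Matrix.of fun i j => ∫ x, φ θ0 x i * φ θ0 x j ∂DX)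
        (hε0 : 0 ≤ ε0)
        (hε0sq : ε0 ^ 2 = ∫ x, (wstar ⬝ᵥ (φ θstar x - φ θ0 x)) ^ 2 ∂DX)
        (hw0 : ∀ ω, w0 ω =
          ((((T1 : ℝ)⁻¹ • ∑ t : Fin T1,
              vecMulVec (φ θ0 (ω.1.1 (Fin.castLE hT1T t) (ω.2 t)))
                (φ θ0 (ω.1.1 (Fin.castLE hT1T t) (ω.2 t)))) +
            (7 * Bφ ^ 2 * Real.log T1 / T1) • (1 : Matrix (Fin d) (Fin d) ℝ))⁻¹) *ᵥ
          ((T1 : ℝ)⁻¹ • ∑ t : Fin T1,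
            (wstar ⬝ᵥ φ θstar (ω.1.1 (Fin.castLE hT1T t) (ω.2 t)) +
              ω.1.2 (Fin.castLE hT1T t)) • φ θ0 (ω.1.1 (Fin.castLE hT1T t) (ω.2 t))))
        (hAexp : ∀ ω (t : Fin T) (h : (t : ℕ) < T1), A t ω = ω.2 ⟨t, h⟩)
        (hAgreedy : ∀ ω (t : Fin T), T1 ≤ (t : ℕ) → ∀ a' : Fin K,
          w0 ω ⬝ᵥ φ θ0 (ω.1.1 t a') ≤ w0 ω ⬝ᵥ φ θ0 (ω.1.1 t (A t ω)))
        (hAstar : ∀ (t : Fin T) (c : Fin T → Fin K → X) (a' : Fin K),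
          wstar ⬝ᵥ φ θstar (c t a') ≤ wstar ⬝ᵥ φ θstar (c t (Astar t c)))
        (hR : ∀ ω, R ω = ∑ t : Fin T,
          (wstar ⬝ᵥ φ θstar (ω.1.1 t (Astar t ω.1.1)) -
            wstar ⬝ᵥ φ θstar (ω.1.1 t (A t ω))))
        (hRint : Integrable R
          (((Measure.pi fun _ : Fin T => DC).prod
              (Measure.pi fun _ : Fin T => νη)).prod
            (Measure.pi fun _ : Fin T1 => UA))),
        ((((Measure.pi fun _ : Fin T => DC).prod
              (Measure.pi fun _ : Fin T => νη)).prod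
            (Measure.pi fun _ : Fin T1 => UA))
          {ω | (mnorm Sig0 (w0 ω - wstar)) ^ 2 ≤
              C * (ε0 ^ 2 * d + d / T1 +
                Real.sqrt (d * Real.log T1) / T1 + Real.log T1 / T1)}
          > ENNReal.ofReal (1 - 4 / Real.sqrt T1)) ∧
        (∫ ω, R ω ∂(((Measure.pi fun _ : Fin T => DC).prod
              (Measure.pi fun _ : Fin T => νη)).prod
            (Measure.pi fun _ : Fin T1 => UA)) ≤
          C * (ε0 * Real.sqrt d * K * T + (T : ℝ) / Real.sqrt T1 + T1 +
            K * T * (Real.sqrt ((d : ℝ) / T1) +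
              (d : ℝ) ^ ((1 : ℝ) / 4) * Real.log T1 ^ ((1 : ℝ) / 4) / Real.sqrt T1 +
              Real.sqrt (Real.log T1 / T1)))) := by
  refine ⟨E2TC.C1 Bw Bφ Bη + 5 * (2 * Bw * Bφ) + 2 + 2 * √(E2TC.C1 Bw Bφ Bη), ?_, ?_⟩
  · have := E2TC.C1_pos Bw Bφ Bη
    positivity
  intro a _ha
  obtain ⟨N0, hN16, hN⟩ := E2TC.exists_N
  refine ⟨N0, ?_⟩
  intro d d0 K T n hK hnT hn X _ DX _ DC _ νη _ UA _ Bθ φ wstar θstar θ0 Sig0 ε0 A Astar w0 R hmarg hφmeas hws hθs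
    hθ0 hφb hmean hbdd hUA hSig0 hε0 hε0sq hw0 hAexp hAgreedy hAstar hR hRint
  have hnN : N0 < n := by exact_mod_cast (le_max_left _ _).trans_lt hn
  obtain ⟨h1, h320⟩ := hN n hnN
  have hn16 : (16 : ℝ) < n := by exact_mod_cast hN16.trans_lt hnN
  have hC1 := E2TC.C1_pos Bw Bφ Bη
  have hM : 0 ≤ 2 * Bw * Bφ := by positivity
  have hw : wstar ⬝ᵥ wstar ≤ Bw ^ 2 := (Real.sqrt_le_left hBw).1 hws
  have hfB : ∀ x, φ θ0 x ⬝ᵥ φ θ0 x ≤ Bφ ^ 2 := fun x => (Real.sqrt_le_left hBφ).1 (hφb θ0 hθ0 x)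
  have hgB : ∀ x, φ θstar x ⬝ᵥ φ θstar x ≤ Bφ ^ 2 := fun x => (Real.sqrt_le_left hBφ).1 (hφb θstar hθs x)
  obtain ⟨l, hl⟩ : ∃ l, l = 7 * Bφ ^ 2 * Real.log n / n := ⟨_, rfl⟩
  have herr : ∀ ω, w0 ω - wstar = E2TC.err (φ θ0) (φ θstar) wstar l (E2TC.samp hnT ω) := fun ω => by
    rw [hw0, hl]; rfl
  obtain ⟨β, hβ⟩ : ∃ β, β = E2TC.C1 Bw Bφ Bη * (ε0 ^ 2 * d + d / n + Real.log n / n) := ⟨_, rfl⟩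
  have hl0 : 0 ≤ Real.log n := by linarith
  have hβ0 : 0 ≤ β := by rw [hβ]; positivity
  obtain ⟨bad, hbad⟩ : ∃ bad : Set ((Fin n → X) × (Fin n → ℝ)), bad =
    {p | ¬ (E2TC.err (φ θ0) (φ θstar) wstar l p ⬝ᵥ ((Matrix.of fun i j => ∫ x, φ θ0 x i * φ θ0 x j ∂DX) *ᵥ
      E2TC.err (φ θ0) (φ θstar) wstar l p) ≤ β)} := ⟨_, rfl⟩
  have hP := E2TC.joint_all (φ θ0) (φ θstar) wstar DX νη hBφ hBη (hφmeas θ0) (hφmeas θstar) hw hfB hgB hmean hbdd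
    h1 h320 (ε0 ^ 2) hε0sq l hl
  rw [← hβ, ← hbad] at hP
  constructor
  · set μ := (((Measure.pi fun _ : Fin T => DC).prod (Measure.pi fun _ : Fin T => νη)).prod
      (Measure.pi fun _ : Fin n => UA)) with hμ
    have hmp := E2TC.samp_mp hnT DX DC νη UA hmarg
    have hb : μ (E2TC.samp hnT ⁻¹' bad) ≤ ENNReal.ofReal (4 / n) := by
      have := Measure.le_map_apply (μ := μ) hmp.measurable.aemeasurable bad
      rw [hμ, hmp.map_eq] at this
      exact this.trans hP
    have hlt : ENNReal.ofReal (4 / n) < ENNReal.ofReal (4 / √n) := by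
      rw [ENNReal.ofReal_lt_ofReal_iff (by positivity)]
      refine div_lt_div_of_pos_left (by norm_num) (by positivity) ?_
      rw [Real.sqrt_lt' (by linarith)]
      nlinarith
    have hsqrt : 4 / √n ≤ 1 := by
      rw [div_le_one (by positivity)]
      exact Real.le_sqrt_of_sq_le (by linarith)
    have hsub : (Set.univ : Set (((Fin T → Fin K → X) × (Fin T → ℝ)) × (Fin n → Fin K))) ⊆
        {ω | (mnorm Sig0 (w0 ω - wstar)) ^ 2 ≤
              (E2TC.C1 Bw Bφ Bη + 5 * (2 * Bw * Bφ) + 2 + 2 * √(E2TC.C1 Bw Bφ Bη)) * (ε0 ^ 2 * d + d / n +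
                Real.sqrt (d * Real.log n) / n + Real.log n / n)} ∪ E2TC.samp hnT ⁻¹' bad := by
      intro ω _
      by_cases hω : E2TC.samp hnT ω ∈ bad
      · exact Or.inr hω
      · left
        rw [hbad] at hω
        have hω' : _ ≤ β := not_not.1 hω
        show (mnorm Sig0 (w0 ω - wstar)) ^ 2 ≤ _
        have hnn : 0 ≤ (w0 ω - wstar) ⬝ᵥ (Sig0 *ᵥ (w0 ω - wstar)) := by
          rw [hSig0, E2TC.Sig_quad DX (φ θ0) (hφmeas θ0) Bφ hfB]
          exact integral_nonneg fun x => sq_nonneg _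
        rw [mnorm, Real.sq_sqrt hnn, hSig0, herr]
        refine hω'.trans ?_
        rw [hβ]
        refine mul_le_mul ?_ ?_ (by positivity) (by positivity)
        · have := Real.sqrt_nonneg (E2TC.C1 Bw Bφ Bη)
          linarith
        · have : 0 ≤ √(d * Real.log n) / n := by positivity
          linarith
    have htot := (measure_mono (μ := μ) hsub).trans (measure_union_le _ _)
    rw [measure_univ] at htot
    by_contra hcon
    have hcon' := not_lt.1 hcon
    have h2 := htot.trans (add_le_add hcon' hb)
    have h3 : ENNReal.ofReal (1 - 4 / √n) + ENNReal.ofReal (4 / n) < 1 := by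
      calc _ < ENNReal.ofReal (1 - 4 / √n) + ENNReal.ofReal (4 / √n) :=
            ENNReal.add_lt_add_left ENNReal.ofReal_ne_top hlt
        _ = 1 := by
            rw [← ENNReal.ofReal_add (by linarith) (by positivity)]; simp
    exact absurd h2 (not_le.2 h3)
  · classical
    obtain ⟨hFm, hFi⟩ := E2TC.round_bound DX DC ((Measure.pi fun _ : Fin n => DX).prod (Measure.pi fun _ : Fin n => νη))
      hmarg (φ θ0) (φ θstar) (hφmeas θ0) (hφmeas θstar) wstar hw hfB hgB ε0 hε0 hε0sq
      (E2TC.err (φ θ0) (φ θstar) wstar l) (E2TC.meas_err (φ θ0) (φ θstar) wstar (hφmeas θ0) (hφmeas θstar) l)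
      β (2 * Bw * Bφ) (4 / n) hβ0 hM (by positivity) bad hbad hP
    have hmain := E2TC.regret_expect hnT DX DC νη UA hmarg _ hFm (2 * Bw * Bφ)
      (K * (2 * ε0 + 2 * √β) + 2 * Bw * Bφ * (4 / n)) hM (by positivity) hFi
      (fun t ω => wstar ⬝ᵥ φ θstar (ω.1.1 t (Astar t ω.1.1)) - wstar ⬝ᵥ φ θstar (ω.1.1 t (A t ω)))
      (fun t ω => sub_nonneg.2 (hAstar t ω.1.1 _))
      (fun t ω => E2TC.regret_M _ _ _ hBw hBφ hw (hgB _) (hgB _))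
      (fun t ω ht => by
        by_cases hω : E2TC.samp hnT ω ∈ bad
        · simp only [hω, if_true]
          exact ENNReal.ofReal_le_ofReal (E2TC.regret_M _ _ _ hBw hBφ hw (hgB _) (hgB _))
        · simp only [hω, if_false]
          have hg := E2TC.regret_good (φ θ0) (φ θstar) wstar (w0 ω) (ω.1.1 t) (Astar t ω.1.1) (A t ω)
            (hAgreedy ω t ht _)
          rw [herr] at hg
          refine (ENNReal.ofReal_le_ofReal hg).trans ?_
          rw [ENNReal.ofReal_sum_of_nonneg fun c _ => by positivity]
          refine Finset.sum_le_sum fun c _ => ?_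
          rw [ENNReal.ofReal_add (by positivity) (by positivity)])
      R hR hRint
    refine hmain.trans (E2TC.final_arith hC1 hM hε0 (Nat.cast_nonneg d) (by linarith) hl0 (Nat.cast_nonneg T)
      (Nat.cast_nonneg K) (by positivity) ?_ hβ)
    rcases Nat.eq_zero_or_pos d with rfl | hd
    · have : ε0 ^ 2 = 0 := by rw [hε0sq]; simp
      have : ε0 = 0 := by simpa using this
      simp [this]
    · refine le_mul_of_one_le_right hε0 ?_
      rw [Real.one_le_sqrt]
      exact_mod_cast hd
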